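/- arXiv:1612.01232 — 3 statements merged into one kernel-verified Lean document; each statement's English description precedes it below -/
import Mathlib

section
/- Let f: ℝ → ℂ be measurable with |f(λ)| ≤ 1 for almost every λ ∈ ℝ and with conj(f(λ)) = f(−λ) for almost every λ ∈ ℝ. Then there exist a probability space and a bivariate Gaussian process B = (B¹_t, B²_t)_{t∈ℝ} with stationary increments such that (i) both B¹ and B² are two-sided standard Brownian motions, and (ii) f is a cross-spectral density of B, i.e. for all reals s < t and s' < t', E[(B¹_t − B¹_s)(B²_{t'} − B²_{s'})] = (1/(2π)) ∫_ℝ ((e^{−iλs} − e^{−iλt})(e^{iλs'} − e^{iλt'})/λ²) f(λ) dλ. -/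
open MeasureTheory ProbabilityTheory

noncomputable section

/-- A real random variable is Gaussian if its law is a (possibly degenerate) normal law. -/
def IsGaussianRV {Ω : Type*} [MeasurableSpace Ω] (μ : Measure Ω) (X : Ω → ℝ) : Prop :=
  ∃ (m : ℝ) (v : NNReal), Measure.map X μ = gaussianReal m v

/-- A bivariate process is a Gaussian process if every finite real linear combination
of its coordinates is a Gaussian random variable. -/
def IsGaussianProcess {Ω : Type*} [MeasurableSpace Ω] (μ : Measure Ω)
    (B : Fin 2 → ℝ → Ω → ℝ) : Prop :=
  ∀ (n : ℕ) (c : Fin n → ℝ) (ν : Fin n → Fin 2) (t : Fin n → ℝ),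
    IsGaussianRV μ (fun ω => ∑ i, c i * B (ν i) (t i) ω)

/-- Second-order stationarity of increments of a bivariate process. -/
def HasStationaryIncrements {Ω : Type*} [MeasurableSpace Ω] (μ : Measure Ω)
    (B : Fin 2 → ℝ → Ω → ℝ) : Prop :=
  ∀ (ν ν' : Fin 2) (t₁ s₁ t₂ s₂ h : ℝ),
    (∫ ω, (B ν (t₁ + h) ω - B ν (s₁ + h) ω) * (B ν' (t₂ + h) ω - B ν' (s₂ + h) ω) ∂μ) =
      ∫ ω, (B ν t₁ ω - B ν s₁ ω) * (B ν' t₂ ω - B ν' s₂ ω) ∂μ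

/-- A two-sided standard Brownian motion: a centered Gaussian process indexed by ℝ with
continuous sample paths, vanishing at 0, and covariance (|t| + |s| - |t - s|)/2. -/
def IsTwoSidedStdBM {Ω : Type*} [MeasurableSpace Ω] (μ : Measure Ω) (W : ℝ → Ω → ℝ) : Prop :=
  (∀ (n : ℕ) (c : Fin n → ℝ) (t : Fin n → ℝ),
      IsGaussianRV μ (fun ω => ∑ i, c i * W (t i) ω)) ∧
  (∀ t, (∫ ω, W t ω ∂μ) = 0) ∧
  (∀ ω, Continuous fun t => W t ω) ∧
  (∀ ω, W 0 ω = 0) ∧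
  (∀ t s : ℝ, (∫ ω, W t ω * W s ω ∂μ) = (|t| + |s| - |t - s|) / 2)

/-- `f` is a cross-spectral density of the pair `(B1, B2)`. -/
def IsCrossSpectralDensity {Ω : Type*} [MeasurableSpace Ω] (μ : Measure Ω)
    (B1 B2 : ℝ → Ω → ℝ) (f : ℝ → ℂ) : Prop :=
  ∀ s t s' t' : ℝ, s < t → s' < t' →
    (((∫ ω, (B1 t ω - B1 s ω) * (B2 t' ω - B2 s' ω) ∂μ) : ℝ) : ℂ) =
      (1 / (2 * (Real.pi : ℂ))) *
        ∫ l : ℝ,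
          (Complex.exp (-(Complex.I * l * s)) - Complex.exp (-(Complex.I * l * t))) *
            (Complex.exp (Complex.I * l * s') - Complex.exp (Complex.I * l * t')) /
              ((l : ℂ) ^ 2) * f l

theorem continuous_integral_exp_Lp {Ω : Type*} [MeasurableSpace Ω] (P : Measure Ω)
    [IsProbabilityMeasure P] (t : ℝ) :
    Continuous fun g : Lp ℝ 2 P => ∫ ω, Complex.exp (Complex.I * ((t * g ω : ℝ) : ℂ)) ∂P := by
  have hint : ∀ g : Lp ℝ 2 P,
      Integrable (fun ω => Complex.exp (Complex.I * ((t * g ω : ℝ) : ℂ))) P := fun g => by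
    refine Integrable.of_bound (C := 1) ?_ (Filter.Eventually.of_forall fun ω => ?_)
    · have := (Lp.aestronglyMeasurable g).aemeasurable
      exact AEMeasurable.aestronglyMeasurable (by fun_prop)
    · exact (Complex.norm_exp_I_mul_ofReal _).le
  refine (LipschitzWith.of_dist_le_mul (K := ‖t‖₊) fun g h => ?_).continuous
  have hgh : MemLp (⇑g - ⇑h) 1 P :=
    ((Lp.memLp g).sub (Lp.memLp h)).mono_exponent (by norm_num)
  rw [dist_eq_norm, ← integral_sub (hint g) (hint h)]
  calc _ ≤ ∫ ω, |t| * ‖(⇑g - ⇑h) ω‖ ∂P := by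
        refine norm_integral_le_of_norm_le (hgh.integrable le_rfl |>.norm.const_mul _)
          (Filter.Eventually.of_forall fun ω => ?_)
        have h1 : Complex.exp (Complex.I * ((t * g ω : ℝ) : ℂ)) -
            Complex.exp (Complex.I * ((t * h ω : ℝ) : ℂ)) =
            Complex.exp (Complex.I * ((t * h ω : ℝ) : ℂ)) *
            (Complex.exp (Complex.I * ((t * (g ω - h ω) : ℝ) : ℂ)) - 1) := by
          rw [mul_sub, ← Complex.exp_add]
          push_cast
          ring_nf
        rw [h1, norm_mul, Complex.norm_exp_I_mul_ofReal, one_mul]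
        refine Real.norm_exp_I_mul_ofReal_sub_one_le.trans ?_
        simp
    _ = |t| * ∫ ω, ‖(⇑g - ⇑h) ω‖ ∂P := integral_const_mul _ _
    _ ≤ ‖t‖₊ * dist g h := by
        rw [coe_nnnorm, Real.norm_eq_abs, Lp.dist_def]
        gcongr
        rw [integral_norm_eq_lintegral_enorm hgh.1, ← eLpNorm_one_eq_lintegral_enorm]
        refine ENNReal.toReal_mono ?_ (eLpNorm_le_eLpNorm_of_exponent_le (by norm_num) hgh.1)
        exact (((Lp.memLp g).sub (Lp.memLp h)).2).ne

theorem map_eq_gaussianReal_of_charFun {Ω : Type*} [MeasurableSpace Ω] {P : Measure Ω}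
    [IsProbabilityMeasure P] (g : Lp ℝ 2 P)
    (hg : ∀ t : ℝ, ∫ ω, Complex.exp (Complex.I * ((t * g ω : ℝ) : ℂ)) ∂P =
      Complex.exp (-(‖g‖ ^ 2 * t ^ 2 / 2 : ℝ))) :
    P.map g = gaussianReal 0 (‖g‖₊ ^ 2) := by
  have hm := (Lp.aestronglyMeasurable g).aemeasurable
  have := Measure.isProbabilityMeasure_map hm
  refine Measure.ext_of_charFun ?_
  ext t
  rw [charFun_gaussianReal, charFun_apply_real, integral_map hm (by fun_prop)]
  convert hg t using 2
  · ext ω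
    push_cast
    ring_nf
  · push_cast
    simp

theorem charFun_of_map_eq_gaussianReal {Ω : Type*} [MeasurableSpace Ω] {P : Measure Ω}
    {X : Ω → ℝ} (hm : AEMeasurable X P) {v : NNReal} (h : P.map X = gaussianReal 0 v) (t : ℝ) :
    ∫ ω, Complex.exp (Complex.I * ((t * X ω : ℝ) : ℂ)) ∂P =
      Complex.exp (-(v * t ^ 2 / 2 : ℝ)) := by
  have h1 := charFun_gaussianReal (μ := 0) (v := v) t
  rw [← h, charFun_apply_real, integral_map hm (by fun_prop)] at h1
  convert h1 using 2
  · ext ω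
    push_cast
    ring_nf
  · push_cast
    simp

theorem norm_sq_Lp_two_real {Ω : Type*} [MeasurableSpace Ω] {P : Measure Ω} (g : Lp ℝ 2 P) :
    ‖g‖ ^ 2 = ∫ ω, g ω ^ 2 ∂P := by
  rw [← real_inner_self_eq_norm_sq, L2.inner_def]
  simp [sq]

theorem map_eq_gaussianReal_of_hasGaussianLaw {Ω : Type*} [MeasurableSpace Ω] {P : Measure Ω}
    [IsProbabilityMeasure P] (g : Lp ℝ 2 P) (hg : HasGaussianLaw g P) (h0 : ∫ ω, g ω ∂P = 0) :
    P.map g = gaussianReal 0 (‖g‖₊ ^ 2) := by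
  rw [hg.map_eq_gaussianReal, h0]
  congr 1
  rw [variance_of_integral_eq_zero hg.aemeasurable h0]
  simp only [← norm_sq_Lp_two_real]
  ext
  simp

/-- The isonormal Gaussian process over a real Hilbert space. -/
theorem exists_isonormal (H : Type) [NormedAddCommGroup H] [InnerProductSpace ℝ H]
    [CompleteSpace H] :
    ∃ (Ω : Type) (_ : MeasurableSpace Ω) (P : Measure Ω) (_ : IsProbabilityMeasure P)
      (W : H →ₗᵢ[ℝ] Lp ℝ 2 P), ∀ h, P.map (W h) = gaussianReal 0 (‖h‖₊ ^ 2) := by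
  classical
  obtain ⟨w, b, -⟩ := exists_hilbertBasis ℝ H
  let P : Measure (w → ℝ) := Measure.infinitePi fun _ => gaussianReal 0 1
  have hmp : ∀ i : w, MeasurePreserving (Function.eval i) P (gaussianReal 0 1) := fun i =>
    measurePreserving_eval_infinitePi _ i
  have hLp : ∀ i : w, MemLp (Function.eval i : (w → ℝ) → ℝ) 2 P := fun i =>
    (memLp_id_gaussianReal 2).comp_measurePreserving (hmp i)
  have hG : ∀ i : w, HasGaussianLaw (Function.eval i : (w → ℝ) → ℝ) P := fun i =>
    ⟨by rw [(hmp i).map_eq]; infer_instance⟩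
  have hind : iIndepFun (fun (i : w) (ω : w → ℝ) => ω i) P :=
    iIndepFun_infinitePi (X := fun _ x => x) (by fun_prop)
  have h0 : ∀ i : w, ∫ ω : w → ℝ, ω i ∂P = 0 := fun i => by
    have := (hmp i).map_eq
    have h := integral_id_gaussianReal (μ := 0) (v := 1)
    rw [← this, integral_map (hmp i).aemeasurable (by fun_prop)] at h
    exact h
  let e : w → Lp ℝ 2 P := fun i => (hLp i).toLp
  have he : Orthonormal ℝ e := by
    rw [orthonormal_iff_ite]
    intro i j
    rw [L2.inner_def]
    have : ∫ ω, inner ℝ (e i ω) (e j ω) ∂P = ∫ ω, ω i * ω j ∂P := by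
      refine integral_congr_ae ?_
      filter_upwards [(hLp i).coeFn_toLp, (hLp j).coeFn_toLp] with ω h1 h2
      simp [e, h1, h2, mul_comm]
    rw [this]
    split_ifs with hij
    · subst hij
      have h := variance_fun_id_gaussianReal (μ := 0) (v := 1)
      rw [variance_of_integral_eq_zero (by fun_prop) integral_id_gaussianReal,
        ← (hmp i).map_eq, integral_map (hmp i).aemeasurable (by fun_prop)] at h
      simpa [sq] using h
    · have := (hind.indepFun hij).integral_mul_eq_mul_integral
        (hLp i).1 (hLp j).1
      simpa [h0] using this
  have hsum : ∀ (s : Finset w) (c : w → ℝ), HasGaussianLaw (∑ i ∈ s, c i • e i : Lp ℝ 2 P) P ∧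
      ∫ ω, (∑ i ∈ s, c i • e i : Lp ℝ 2 P) ω ∂P = 0 := by
    intro s c
    have hae : ((∑ i ∈ s, c i • e i : Lp ℝ 2 P) : (w → ℝ) → ℝ) =ᵐ[P]
        fun ω => ∑ i : s, c i * ω i := by
      have h1 : ∀ᵐ ω ∂P, ∀ i : s, (c i • e i : Lp ℝ 2 P) ω = c i * ω i := by
        rw [ae_all_iff]
        intro i
        filter_upwards [Lp.coeFn_smul (c i) (e i), (hLp i).coeFn_toLp] with ω h1 h2
        simp [h1, e, h2]
      filter_upwards [h1, Lp.coeFn_finsetSum s fun i => c i • e i] with ω h1 h2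
      rw [h2, Finset.sum_apply, ← Finset.sum_coe_sort]
      exact Finset.sum_congr rfl fun i _ => h1 i
    have hi : iIndepFun (fun (i : s) (ω : w → ℝ) => ω i) P :=
      hind.precomp Subtype.val_injective
    have hi' : HasGaussianLaw (fun ω : w → ℝ => ∑ i : s, c i * ω i) P := by
      refine iIndepFun.hasGaussianLaw_fun_sum (X := fun (i : s) (ω : w → ℝ) => c i * ω i)
        (fun i => (hG i).fun_smul (c i)) ?_
      exact hi.comp (fun (i : s) (x : ℝ) => c i * x) (by fun_prop)
    refine ⟨hi'.congr hae.symm, ?_⟩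
    rw [integral_congr_ae hae, integral_finsetSum]
    · simp [integral_const_mul, h0]
    · exact fun i _ => ((hLp i).integrable (by norm_num)).const_mul _
  let W : H →ₗᵢ[ℝ] Lp ℝ 2 P :=
    he.orthogonalFamily.linearIsometry.comp b.repr.toLinearIsometry
  refine ⟨w → ℝ, inferInstance, P, inferInstance, W, fun h => ?_⟩
  have hW : HasSum (fun i => b.repr h i • e i) (W h) := by
    have := he.orthogonalFamily.hasSum_linearIsometry (b.repr h)
    simpa [W] using this
  rw [← W.nnnorm_map h]
  refine map_eq_gaussianReal_of_charFun _ fun t => ?_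
  have hcl : IsClosed {g : Lp ℝ 2 P | ∫ ω, Complex.exp (Complex.I * ((t * g ω : ℝ) : ℂ)) ∂P =
      Complex.exp (-(‖g‖ ^ 2 * t ^ 2 / 2 : ℝ))} :=
    isClosed_eq (continuous_integral_exp_Lp P t) (by fun_prop)
  refine hcl.mem_of_tendsto hW (Filter.Eventually.of_forall fun s => ?_)
  obtain ⟨h1, h2⟩ := hsum s (b.repr h)
  simpa using charFun_of_map_eq_gaussianReal h1.aemeasurable
    (map_eq_gaussianReal_of_hasGaussianLaw _ h1 h2) t

theorem integrable_one_sub_cos_div_sq (t : ℝ) :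
    Integrable fun x : ℝ => (1 - Real.cos (t * x)) / x ^ 2 := by
  refine Integrable.mono' (integrable_inv_one_add_sq.const_mul (t ^ 2 / 2 + 2))
    (Measurable.aestronglyMeasurable (by fun_prop)) (Filter.Eventually.of_forall fun x => ?_)
  have h1 := Real.one_sub_sq_div_two_le_cos (x := t * x)
  have h2 := Real.neg_one_le_cos (t * x)
  have h3 := Real.cos_le_one (t * x)
  rw [Real.norm_of_nonneg (by positivity [sub_nonneg.2 h3]), ← div_eq_mul_inv]
  rcases eq_or_ne x 0 with rfl | hx
  · simp; positivity
  · rw [div_le_div_iff₀ (by positivity) (by positivity)]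
    nlinarith [sq_nonneg x]

theorem integral_one_sub_cos_mul_exp_neg {u : ℝ} (hu : 0 < u) :
    ∫ x in Set.Ioi (0 : ℝ), (1 - Real.cos x) * Real.exp (-(u * x)) = 1 / u - u / (1 + u ^ 2) := by
  have hre : (-(u : ℂ) + Complex.I).re < 0 := by simpa
  have h1 := integral_exp_mul_complex_Ioi hre 0
  have h1' := (integrableOn_exp_mul_complex_Ioi hre 0)
  have h2 : ∀ x : ℝ, Real.cos x * Real.exp (-(u * x)) =
      (Complex.exp ((-(u : ℂ) + Complex.I) * x)).re := fun x => by
    simp [Complex.exp_re, mul_comm]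
  have h3 : IntegrableOn (fun x : ℝ => Real.exp (-(u * x))) (Set.Ioi 0) := by
    simpa using integrableOn_exp_mul_Ioi (neg_lt_zero.2 hu) 0
  have h4 : IntegrableOn (fun x : ℝ => Real.cos x * Real.exp (-(u * x))) (Set.Ioi 0) := by
    simp_rw [h2]; exact h1'.re
  simp_rw [sub_mul, one_mul]
  rw [integral_sub h3 h4]
  simp_rw [h2]
  have h5 := integral_re h1'
  simp only [RCLike.re_to_complex] at h5
  have h6 := integral_exp_mul_Ioi (neg_lt_zero.2 hu) 0
  simp only [neg_mul] at h6
  rw [h5, h1, h6]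
  simp [Complex.div_re, Complex.normSq_apply]
  field_simp
  ring

theorem integral_mul_exp_neg_mul {x : ℝ} (hx : 0 < x) :
    ∫ u in Set.Ioi (0 : ℝ), u * Real.exp (-(u * x)) = 1 / x ^ 2 := by
  have := Real.integral_rpow_mul_exp_neg_mul_Ioi (a := 2) (by norm_num) hx
  norm_num [Real.Gamma_two] at this
  simpa [mul_comm] using this

theorem integral_Ioi_one_sub_cos_div_sq :
    ∫ x in Set.Ioi (0 : ℝ), (1 - Real.cos x) / x ^ 2 = Real.pi / 2 := by
  let F : ℝ → ℝ → ℝ := fun x u => (1 - Real.cos x) * (u * Real.exp (-(u * x)))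
  have hF0 : ∀ x u : ℝ, 0 < u → 0 ≤ F x u := fun x u hu =>
    mul_nonneg (sub_nonneg.2 (Real.cos_le_one x)) (by positivity)
  have hFx : ∀ x : ℝ, 0 < x → ∫ u in Set.Ioi (0 : ℝ), F x u = (1 - Real.cos x) / x ^ 2 :=
    fun x hx => by
      rw [integral_const_mul, integral_mul_exp_neg_mul hx]
      ring
  have hint : Integrable (Function.uncurry F)
      ((volume.restrict (Set.Ioi (0 : ℝ))).prod (volume.restrict (Set.Ioi (0 : ℝ)))) := by
    rw [integrable_prod_iff (Measurable.aestronglyMeasurable (by fun_prop))]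
    constructor
    · filter_upwards [ae_restrict_mem measurableSet_Ioi] with x hx
      have hx : 0 < x := hx
      have h : IntegrableOn (fun u : ℝ => u * Real.exp (-(u * x))) (Set.Ioi 0) := by
        refine Integrable.of_integral_ne_zero ?_
        rw [integral_mul_exp_neg_mul hx]
        positivity
      exact h.const_mul (1 - Real.cos x)
    · have h := (integrable_one_sub_cos_div_sq 1).integrableOn (s := Set.Ioi 0)
      refine h.congr ?_
      filter_upwards [ae_restrict_mem measurableSet_Ioi] with x hx
      rw [one_mul, ← hFx x hx]
      refine setIntegral_congr_fun measurableSet_Ioi fun u hu => ?_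
      exact (Real.norm_of_nonneg (hF0 x u hu)).symm
  calc _ = ∫ x in Set.Ioi (0 : ℝ), ∫ u in Set.Ioi (0 : ℝ), F x u :=
        setIntegral_congr_fun measurableSet_Ioi fun x hx => (hFx x hx).symm
    _ = ∫ u in Set.Ioi (0 : ℝ), ∫ x in Set.Ioi (0 : ℝ), F x u := integral_integral_swap hint
    _ = ∫ u in Set.Ioi (0 : ℝ), (1 + u ^ 2)⁻¹ := by
        refine setIntegral_congr_fun measurableSet_Ioi fun u hu => ?_
        have hu : 0 < u := hu
        have h : ∀ x, F x u = u * ((1 - Real.cos x) * Real.exp (-(u * x))) := fun x => by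
          simp only [F]; ring
        simp_rw [h]
        rw [integral_const_mul, integral_one_sub_cos_mul_exp_neg hu]
        field_simp
        ring
    _ = Real.pi / 2 := by simp [integral_Ioi_inv_one_add_sq]

theorem integral_one_sub_cos_div_sq (t : ℝ) :
    ∫ x : ℝ, (1 - Real.cos (t * x)) / x ^ 2 = Real.pi * |t| := by
  have h1 : ∫ x : ℝ, (1 - Real.cos x) / x ^ 2 = Real.pi := by
    have := integral_comp_abs (f := fun x : ℝ => (1 - Real.cos x) / x ^ 2)
    simp only [Real.cos_abs, sq_abs] at this
    rw [this, integral_Ioi_one_sub_cos_div_sq]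
    ring
  rcases eq_or_ne t 0 with rfl | ht
  · simp
  have h2 := Measure.integral_comp_mul_left (fun x : ℝ => (1 - Real.cos x) / x ^ 2) t
  have h3 : ∀ x : ℝ, (1 - Real.cos (t * x)) / x ^ 2 =
      t ^ 2 * ((1 - Real.cos (t * x)) / (t * x) ^ 2) := fun x => by
    rcases eq_or_ne x 0 with rfl | hx
    · simp
    · field_simp
  simp_rw [h3]
  rw [integral_const_mul, h2, h1, abs_inv, smul_eq_mul, ← sq_abs t]
  have : |t| ≠ 0 := abs_ne_zero.2 ht
  field_simp

/-- The largest dyadic point of level `n` below `t`. -/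
def dyadicFloor (n : ℕ) (t : ℝ) : ℝ := (⌊2 ^ n * t⌋ : ℝ) / 2 ^ n

theorem abs_dyadicFloor_sub_le (n : ℕ) (t : ℝ) : |dyadicFloor n t - t| ≤ (1 / 2) ^ n := by
  have h1 := Int.floor_le ((2 : ℝ) ^ n * t)
  have h2 := Int.lt_floor_add_one ((2 : ℝ) ^ n * t)
  have h3 : dyadicFloor n t - t = ((⌊2 ^ n * t⌋ : ℝ) - 2 ^ n * t) / 2 ^ n := by
    simp only [dyadicFloor]
    field_simp
  rw [h3, abs_div, abs_of_pos (by positivity : (0 : ℝ) < 2 ^ n), one_div_pow]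
  gcongr
  rw [abs_le]
  constructor <;> linarith

/-- The dyadic increments of `x` over `[-N, N]` at level `n` are at most `C * r ^ n`. -/
def DyadicIncrementBound (x : ℝ → ℝ) (N : ℕ) (C r : ℝ) : Prop :=
  ∀ (n : ℕ) (k : ℤ), |k| ≤ N * 2 ^ n → |x ((k + 1) / 2 ^ n) - x (k / 2 ^ n)| ≤ C * r ^ n

theorem abs_floor_le {N n : ℕ} {t : ℝ} (ht : |t| ≤ N) : |⌊2 ^ n * t⌋| ≤ (N : ℤ) * 2 ^ n := by
  rw [abs_le] at ht ⊢
  constructor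
  · rw [Int.le_floor]
    push_cast
    nlinarith [pow_pos (two_pos : (0 : ℝ) < 2) n]
  · rw [Int.floor_le_iff]
    push_cast
    nlinarith [pow_pos (two_pos : (0 : ℝ) < 2) n]

theorem DyadicIncrementBound.abs_succ_sub_le {x : ℝ → ℝ} {N : ℕ} {C r : ℝ} (hC : 0 ≤ C)
    (hr : 0 ≤ r) (hx : DyadicIncrementBound x N C r) {t : ℝ} (ht : |t| ≤ N) (n : ℕ) :
    |x (dyadicFloor (n + 1) t) - x (dyadicFloor n t)| ≤ C * r ^ (n + 1) := by
  have h1 := Int.floor_le ((2 : ℝ) ^ n * t)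
  have h2 := Int.lt_floor_add_one ((2 : ℝ) ^ n * t)
  set k := ⌊(2 : ℝ) ^ n * t⌋ with hk
  have hkN : |k| ≤ (N : ℤ) * 2 ^ n := abs_floor_le ht
  have h3 : dyadicFloor n t = (2 * k : ℤ) / 2 ^ (n + 1) := by
    simp only [dyadicFloor, ← hk]
    push_cast
    rw [pow_succ]
    field_simp
  have h4 : 2 * k ≤ ⌊(2 : ℝ) ^ (n + 1) * t⌋ := by
    rw [Int.le_floor]
    push_cast
    rw [pow_succ]; linarith
  have h5 : ⌊(2 : ℝ) ^ (n + 1) * t⌋ < 2 * k + 2 := by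
    rw [Int.floor_lt]
    push_cast
    rw [pow_succ]; linarith
  have h6 : ⌊(2 : ℝ) ^ (n + 1) * t⌋ = 2 * k ∨ ⌊(2 : ℝ) ^ (n + 1) * t⌋ = 2 * k + 1 := by omega
  rw [h3]
  rcases h6 with h6 | h6
  · simp only [dyadicFloor, h6, sub_self, abs_zero]
    positivity
  · have := hx (n + 1) (2 * k) (by rw [abs_mul, pow_succ]; norm_num; linarith)
    simpa [dyadicFloor, h6] using this

theorem DyadicIncrementBound.abs_sub_le {x : ℝ → ℝ} {N : ℕ} {C r : ℝ} (hC : 0 ≤ C)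
    (hr : 0 ≤ r) (hx : DyadicIncrementBound x N C r) {s t : ℝ} (hs : |s| ≤ N) (ht : |t| ≤ N)
    (n : ℕ) (hst : |s - t| ≤ (1 / 2) ^ n) :
    |x (dyadicFloor n s) - x (dyadicFloor n t)| ≤ C * r ^ n := by
  wlog hle : s ≤ t generalizing s t
  · rw [abs_sub_comm]
    exact this ht hs (by rwa [abs_sub_comm]) (le_of_not_ge hle)
  have h1 := Int.floor_le ((2 : ℝ) ^ n * s)
  have h2 := Int.lt_floor_add_one ((2 : ℝ) ^ n * s)
  have hkN : |⌊(2 : ℝ) ^ n * s⌋| ≤ (N : ℤ) * 2 ^ n := abs_floor_le hs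
  have h3 : (2 : ℝ) ^ n * t ≤ 2 ^ n * s + 1 := by
    rw [abs_sub_comm, abs_of_nonneg (by linarith), one_div_pow, le_div_iff₀ (by positivity)] at hst
    linarith
  have h4 : ⌊(2 : ℝ) ^ n * s⌋ ≤ ⌊(2 : ℝ) ^ n * t⌋ := Int.floor_le_floor (by gcongr)
  have h5 : ⌊(2 : ℝ) ^ n * t⌋ ≤ ⌊(2 : ℝ) ^ n * s⌋ + 1 := by
    rw [← Int.floor_add_one]
    exact Int.floor_le_floor h3
  have h6 : ⌊(2 : ℝ) ^ n * t⌋ = ⌊(2 : ℝ) ^ n * s⌋ ∨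
      ⌊(2 : ℝ) ^ n * t⌋ = ⌊(2 : ℝ) ^ n * s⌋ + 1 := by omega
  rcases h6 with h6 | h6
  · simp only [dyadicFloor, h6, sub_self, abs_zero]
    positivity
  · have := hx n _ hkN
    rw [abs_sub_comm]
    simpa [dyadicFloor, h6] using this

/-- The limit of `x` along dyadic approximations of `t`. -/
def dyadicLim (x : ℝ → ℝ) (t : ℝ) : ℝ :=
  Filter.atTop.limUnder fun n => x (dyadicFloor n t)

theorem DyadicIncrementBound.dist_dyadicLim_le {x : ℝ → ℝ} {N : ℕ} {C r : ℝ} (hC : 0 ≤ C)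
    (hr : 0 ≤ r) (hr1 : r < 1) (hx : DyadicIncrementBound x N C r) {t : ℝ} (ht : |t| ≤ N) (n : ℕ) :
    dist (x (dyadicFloor n t)) (dyadicLim x t) ≤ C * r * r ^ n / (1 - r) := by
  have h : ∀ n, dist (x (dyadicFloor n t)) (x (dyadicFloor (n + 1) t)) ≤ C * r * r ^ n := fun n => by
    rw [dist_comm, mul_assoc, ← pow_succ']
    exact hx.abs_succ_sub_le hC hr ht n
  exact dist_le_of_le_geometric_of_tendsto _ _ hr1 h
    (cauchySeq_of_le_geometric _ _ hr1 h).tendsto_limUnder n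

theorem DyadicIncrementBound.tendsto_dyadicLim {x : ℝ → ℝ} {N : ℕ} {C r : ℝ} (hC : 0 ≤ C)
    (hr : 0 ≤ r) (hr1 : r < 1) (hx : DyadicIncrementBound x N C r) {t : ℝ} (ht : |t| ≤ N) :
    Filter.Tendsto (fun n => x (dyadicFloor n t)) Filter.atTop (nhds (dyadicLim x t)) := by
  rw [tendsto_iff_dist_tendsto_zero]
  refine squeeze_zero (fun _ => dist_nonneg) (hx.dist_dyadicLim_le hC hr hr1 ht) ?_
  simpa using ((tendsto_pow_atTop_nhds_zero_of_lt_one hr hr1).const_mul (C * r)).div_const (1 - r)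

theorem continuous_dyadicLim {x : ℝ → ℝ} {r : ℝ} (hr : 0 ≤ r) (hr1 : r < 1)
    (hx : ∀ N : ℕ, ∃ C, 0 ≤ C ∧ DyadicIncrementBound x N C r) : Continuous (dyadicLim x) := by
  rw [continuous_iff_continuousAt]
  intro t
  obtain ⟨N, hN⟩ := exists_nat_ge (|t| + 1)
  obtain ⟨C, hC, hxN⟩ := hx N
  rw [Metric.continuousAt_iff]
  intro ε hε
  have hlim : Filter.Tendsto (fun n : ℕ => 2 * (C * r * r ^ n / (1 - r)) + C * r ^ n)
      Filter.atTop (nhds 0) := by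
    have h := tendsto_pow_atTop_nhds_zero_of_lt_one hr hr1
    simpa using (((h.const_mul (C * r)).div_const (1 - r)).const_mul 2).add (h.const_mul C)
  obtain ⟨n, hn⟩ := (hlim.eventually (gt_mem_nhds hε)).exists
  refine ⟨(1 / 2) ^ n, by positivity, fun {s} hs => ?_⟩
  rw [Real.dist_eq] at hs
  have hs1 : |s - t| ≤ 1 := hs.le.trans (pow_le_one₀ (by norm_num) (by norm_num))
  have hsN : |s| ≤ N := by
    have := abs_add_le (s - t) t
    rw [sub_add_cancel] at this
    linarith
  have htN : |t| ≤ N := by linarith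
  have h1 := hxN.dist_dyadicLim_le hC hr hr1 hsN n
  have h2 := hxN.dist_dyadicLim_le hC hr hr1 htN n
  have h3 := hxN.abs_sub_le hC hr hsN htN n hs.le
  rw [← Real.dist_eq] at h3
  have h4 := dist_triangle4 (dyadicLim x s) (x (dyadicFloor n s)) (x (dyadicFloor n t))
    (dyadicLim x t)
  rw [dist_comm (dyadicLim x s) (x _)] at h4
  linarith

theorem ae_dyadicIncrementBound {Ω : Type*} [MeasurableSpace Ω] {P : Measure Ω} {X : ℝ → Ω → ℝ}
    (hX : ∀ t, AEMeasurable (X t) P) {K : NNReal}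
    (hK : ∀ s t, ∫⁻ ω, ‖X s ω - X t ω‖ₑ ^ 4 ∂P ≤ K * ENNReal.ofReal (|s - t| ^ 2)) (N : ℕ) :
    ∀ᵐ ω ∂P, ∃ C, 0 ≤ C ∧ DyadicIncrementBound (fun t => X t ω) N C (19 / 20) := by
  let D : ℕ → ℤ → Ω → ENNReal := fun n k ω =>
    ENNReal.ofReal ((3 / 2) ^ n) * ‖X ((k + 1) / 2 ^ n) ω - X (k / 2 ^ n) ω‖ₑ ^ 4
  let I : ℕ → Finset ℤ := fun n => Finset.Icc (-(N * 2 ^ n)) (N * 2 ^ n)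
  let S : Ω → ENNReal := fun ω => ∑' n, ∑ k ∈ I n, D n k ω
  have hDm : ∀ n k, AEMeasurable (D n k) P := fun n k =>
    (((hX _).sub (hX _)).enorm.pow_const 4).const_mul _
  have hSm : ∀ n, AEMeasurable (fun ω => ∑ k ∈ I n, D n k ω) P := fun n =>
    Finset.aemeasurable_fun_sum _ fun k _ => hDm n k
  have hD : ∀ n k, ∫⁻ ω, D n k ω ∂P ≤ K * ENNReal.ofReal ((3 / 8) ^ n) := fun n k => by
    have hm : AEMeasurable (fun ω => ‖X ((k + 1) / 2 ^ n) ω - X (k / 2 ^ n) ω‖ₑ ^ 4) P :=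
      ((hX _).sub (hX _)).enorm.pow_const 4
    rw [lintegral_const_mul'' _ hm]
    refine (mul_le_mul_right (hK _ _) _).trans (le_of_eq ?_)
    rw [mul_left_comm, ← ENNReal.ofReal_mul (by positivity)]
    congr 2
    rw [← sub_div, add_sub_cancel_left, abs_of_pos (by positivity), one_div, inv_pow, ← pow_mul,
      mul_comm n 2, pow_mul, ← div_eq_mul_inv, ← div_pow]
    norm_num
  have hsum : ∫⁻ ω, S ω ∂P ≠ ⊤ := by
    rw [lintegral_tsum hSm]
    have h1 : ∀ n, ∫⁻ ω, ∑ k ∈ I n, D n k ω ∂P ≤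
        K * ENNReal.ofReal ((2 * N + 1) * (3 / 4) ^ n) := fun n => by
      rw [lintegral_finsetSum' _ fun k _ => hDm n k]
      refine (Finset.sum_le_card_nsmul _ _ _ fun k _ => hD n k).trans ?_
      have hcard : ((I n).card : ℝ) ≤ (2 * N + 1) * 2 ^ n := by
        have : ((I n).card : ℤ) = 2 * (N * 2 ^ n) + 1 := by
          rw [Int.card_Icc_of_le]
          · ring
          · have : (0 : ℤ) ≤ N * 2 ^ n := by positivity
            linarith
        have h2 : ((I n).card : ℝ) = 2 * (N * 2 ^ n) + 1 := by exact_mod_cast this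
        have h3 : (1 : ℝ) ≤ 2 ^ n := one_le_pow₀ (by norm_num)
        rw [h2]
        linarith
      rw [nsmul_eq_mul, mul_left_comm, ← ENNReal.ofReal_natCast,
        ← ENNReal.ofReal_mul (Nat.cast_nonneg _)]
      refine mul_le_mul_right (ENNReal.ofReal_le_ofReal ?_) _
      calc ((I n).card : ℝ) * (3 / 8) ^ n ≤ (2 * N + 1) * 2 ^ n * (3 / 8) ^ n := by gcongr
        _ = (2 * N + 1) * (3 / 4) ^ n := by
          rw [mul_assoc, ← mul_pow]
          norm_num
    refine ne_top_of_le_ne_top ?_ (ENNReal.tsum_le_tsum h1)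
    rw [ENNReal.tsum_mul_left]
    refine ENNReal.mul_ne_top ENNReal.coe_ne_top ?_
    refine Summable.tsum_ofReal_ne_top ?_
    exact (summable_geometric_of_lt_one (by norm_num) (by norm_num)).mul_left _
  filter_upwards [ae_lt_top' (AEMeasurable.tsum hSm) hsum] with ω hω
  refine ⟨1 + (S ω).toReal, by positivity, fun n k hk => ?_⟩
  have h1 : D n k ω ≤ S ω := by
    refine le_trans ?_ (ENNReal.le_tsum n)
    exact Finset.single_le_sum (f := fun k => D n k ω) (fun _ _ => zero_le)
      (Finset.mem_Icc.2 (abs_le.1 hk))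
  have h2 := ENNReal.toReal_mono hω.ne h1
  simp only [D, ENNReal.toReal_mul, ENNReal.toReal_pow, toReal_enorm, Real.norm_eq_abs] at h2
  rw [ENNReal.toReal_ofReal (by positivity)] at h2
  set a := |X ((k + 1) / 2 ^ n) ω - X (k / 2 ^ n) ω|
  set s := (S ω).toReal
  have hs : 0 ≤ s := ENNReal.toReal_nonneg
  refine le_of_pow_le_pow_left₀ (n := 4) (by norm_num) (by positivity) ?_
  have h3 : (1 : ℝ) ≤ (3 / 2) ^ n * ((19 / 20) ^ n) ^ 4 := by
    rw [← pow_mul, mul_comm n 4, pow_mul, ← mul_pow]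
    exact one_le_pow₀ (by norm_num)
  have h4 : s ≤ (1 + s) ^ 4 := by
    have := one_le_pow₀ (n := 3) (by linarith : 1 ≤ 1 + s)
    nlinarith
  have h5 : a ^ 4 * 1 ≤ a ^ 4 * ((3 / 2) ^ n * ((19 / 20) ^ n) ^ 4) := by gcongr
  calc a ^ 4 ≤ ((3 / 2) ^ n * a ^ 4) * ((19 / 20) ^ n) ^ 4 := by linarith
    _ ≤ (1 + s) ^ 4 * ((19 / 20) ^ n) ^ 4 := by gcongr; linarith
    _ = _ := by rw [mul_pow]

theorem ae_tendsto_dyadicFloor {Ω : Type*} [MeasurableSpace Ω] {P : Measure Ω} {X : ℝ → Ω → ℝ}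
    (hX : ∀ t, AEMeasurable (X t) P) {K : NNReal}
    (hK : ∀ s t, ∫⁻ ω, ‖X s ω - X t ω‖ₑ ^ 4 ∂P ≤ K * ENNReal.ofReal (|s - t| ^ 2)) (t : ℝ) :
    ∀ᵐ ω ∂P, Filter.Tendsto (fun n => X (dyadicFloor n t) ω) Filter.atTop (nhds (X t ω)) := by
  have hm : ∀ n : ℕ, AEMeasurable (fun ω => ‖X (dyadicFloor n t) ω - X t ω‖ₑ ^ 4) P := fun n =>
    ((hX _).sub (hX _)).enorm.pow_const 4
  have hsum : ∫⁻ ω, ∑' n, ‖X (dyadicFloor n t) ω - X t ω‖ₑ ^ 4 ∂P ≠ ⊤ := by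
    rw [lintegral_tsum hm]
    have h1 : ∀ n, ∫⁻ ω, ‖X (dyadicFloor n t) ω - X t ω‖ₑ ^ 4 ∂P ≤
        K * ENNReal.ofReal ((1 / 4) ^ n) := fun n => by
      refine (hK _ _).trans ?_
      gcongr
      have := abs_dyadicFloor_sub_le n t
      calc _ ≤ ((1 / 2 : ℝ) ^ n) ^ 2 := by gcongr
        _ = _ := by rw [← pow_mul, mul_comm, pow_mul]; norm_num
    refine ne_top_of_le_ne_top ?_ (ENNReal.tsum_le_tsum h1)
    rw [ENNReal.tsum_mul_left]
    refine ENNReal.mul_ne_top ENNReal.coe_ne_top (Summable.tsum_ofReal_ne_top ?_)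
    exact summable_geometric_of_lt_one (by norm_num) (by norm_num)
  filter_upwards [ae_lt_top' (AEMeasurable.tsum hm) hsum] with ω hω
  have h1 := ENNReal.tendsto_atTop_zero_of_tsum_ne_top hω.ne
  have h2 := (ENNReal.tendsto_toReal ENNReal.zero_ne_top).comp h1
  have h3 := h2.sqrt.sqrt
  rw [tendsto_iff_dist_tendsto_zero]
  simp only [ENNReal.toReal_zero, Real.sqrt_zero] at h3
  refine h3.congr fun n => ?_
  simp only [Function.comp, ENNReal.toReal_pow, toReal_enorm, Real.norm_eq_abs, Real.dist_eq]
  rw [show 4 = 2 * 2 from rfl, pow_mul, Real.sqrt_sq (by positivity), Real.sqrt_sq (by positivity)]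

/-- Kolmogorov's continuity theorem on the line, for fourth moments. -/
theorem exists_continuous_modification {Ω : Type*} [MeasurableSpace Ω] {P : Measure Ω}
    {X : ℝ → Ω → ℝ} (hX : ∀ t, AEMeasurable (X t) P) {K : NNReal}
    (hK : ∀ s t, ∫⁻ ω, ‖X s ω - X t ω‖ₑ ^ 4 ∂P ≤ K * ENNReal.ofReal (|s - t| ^ 2)) :
    ∃ Y : ℝ → Ω → ℝ, (∀ ω, Continuous fun t => Y t ω) ∧ ∀ t, Y t =ᵐ[P] X t := by
  classical
  let G : Set Ω := {ω | ∀ N : ℕ, ∃ C, 0 ≤ C ∧ DyadicIncrementBound (fun t => X t ω) N C (19 / 20)}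
  have hG : ∀ᵐ ω ∂P, ω ∈ G := ae_all_iff.2 fun N => ae_dyadicIncrementBound hX hK N
  refine ⟨fun t ω => if ω ∈ G then dyadicLim (fun t => X t ω) t else 0, fun ω => ?_, fun t => ?_⟩
  · by_cases hω : ω ∈ G
    · simpa only [hω, if_true] using continuous_dyadicLim (by norm_num) (by norm_num) hω
    · simpa only [hω, if_false] using continuous_const
  · filter_upwards [hG, ae_tendsto_dyadicFloor hX hK t] with ω hω ht
    simp only [hω, if_true]
    obtain ⟨N, hN⟩ := exists_nat_ge |t|
    obtain ⟨C, hC, hb⟩ := hω N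
    exact tendsto_nhds_unique (hb.tendsto_dyadicLim hC (by norm_num) (by norm_num) hN) ht

/-- The normalised Fourier transform of the indicator of `(0, t]`, up to a unimodular constant. -/
def brownianKernel (t l : ℝ) : ℂ :=
  (1 - Complex.exp (-(Complex.I * l * t))) / l / (Real.sqrt (2 * Real.pi) : ℝ)

theorem brownianKernel_zero (l : ℝ) : brownianKernel 0 l = 0 := by
  simp [brownianKernel]

theorem measurable_brownianKernel (t : ℝ) : Measurable (brownianKernel t) := by
  unfold brownianKernel
  fun_prop

theorem brownianKernel_sub (t s l : ℝ) : brownianKernel t l - brownianKernel s l =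
    (Complex.exp (-(Complex.I * l * s)) - Complex.exp (-(Complex.I * l * t))) / l /
      (Real.sqrt (2 * Real.pi) : ℝ) := by
  simp only [brownianKernel]
  ring

theorem brownianKernel_add_sub_add (t s h l : ℝ) :
    brownianKernel (t + h) l - brownianKernel (s + h) l =
    Complex.exp (Complex.I * ((-(l * h) : ℝ) : ℂ)) *
      (brownianKernel t l - brownianKernel s l) := by
  rw [brownianKernel_sub, brownianKernel_sub, ← mul_div_assoc, ← mul_div_assoc, mul_sub,
    ← Complex.exp_add, ← Complex.exp_add]
  push_cast
  ring_nf

theorem norm_brownianKernel_sub_sq (t s l : ℝ) :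
    ‖brownianKernel t l - brownianKernel s l‖ ^ 2 =
      Real.pi⁻¹ * ((1 - Real.cos ((t - s) * l)) / l ^ 2) := by
  have h : brownianKernel t l - brownianKernel s l =
      Complex.exp (Complex.I * ((-(l * s) : ℝ) : ℂ)) * brownianKernel (t - s) l := by
    have := brownianKernel_add_sub_add (t - s) 0 s l
    simpa [brownianKernel_zero] using this
  rw [h, norm_mul, Complex.norm_exp_I_mul_ofReal, one_mul, brownianKernel, norm_div, norm_div,
    div_pow, div_pow, Complex.norm_real, Complex.norm_real, Real.norm_eq_abs, Real.norm_eq_abs,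
    sq_abs, sq_abs, Real.sq_sqrt (by positivity), ← Complex.normSq_eq_norm_sq,
    show -(Complex.I * (l : ℂ) * ((t - s : ℝ) : ℂ)) = ((-((t - s) * l) : ℝ) : ℂ) * Complex.I by
      push_cast; ring, Complex.normSq_apply]
  simp only [Complex.sub_re, Complex.sub_im, Complex.one_re, Complex.one_im,
    Complex.exp_ofReal_mul_I_re, Complex.exp_ofReal_mul_I_im, Real.cos_neg, Real.sin_neg]
  have h2 : (1 - Real.cos ((t - s) * l)) * (1 - Real.cos ((t - s) * l)) +
      (0 - -Real.sin ((t - s) * l)) * (0 - -Real.sin ((t - s) * l)) =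
      2 * (1 - Real.cos ((t - s) * l)) := by
    nlinarith [Real.sin_sq_add_cos_sq ((t - s) * l)]
  rw [h2]
  field_simp

theorem memLp_brownianKernel (t : ℝ) : MemLp (brownianKernel t) 2 := by
  rw [memLp_two_iff_integrable_sq_norm (measurable_brownianKernel t).aestronglyMeasurable]
  have h : ∀ l, ‖brownianKernel t l‖ ^ 2 = Real.pi⁻¹ * ((1 - Real.cos (t * l)) / l ^ 2) :=
    fun l => by simpa [brownianKernel_zero] using norm_brownianKernel_sub_sq t 0 l
  simp_rw [h]
  exact (integrable_one_sub_cos_div_sq t).const_mul _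

/-- The pointwise directions of the two components: `(1, 0)` and `(conj f, √(1 - |f|²))`. -/
def crossDirection (f : ℝ → ℂ) (ν : Fin 2) (l : ℝ) : WithLp 2 (ℂ × ℂ) :=
  if ν = 0 then WithLp.toLp 2 (1, 0)
  else WithLp.toLp 2 ((starRingEnd ℂ) (f l), (Real.sqrt (1 - ‖f l‖ ^ 2) : ℝ))

theorem norm_crossDirection {f : ℝ → ℂ} {l : ℝ} (hf : ‖f l‖ ≤ 1) (ν : Fin 2) :
    ‖crossDirection f ν l‖ = 1 := by
  have h : 0 ≤ 1 - ‖f l‖ ^ 2 := by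
    have := pow_le_one₀ (n := 2) (norm_nonneg (f l)) hf
    linarith
  unfold crossDirection
  split_ifs
  · simp
  · simp [WithLp.prod_norm_eq_of_L2, Real.sq_sqrt h]

theorem measurable_crossDirection {f : ℝ → ℂ} (hf : Measurable f) (ν : Fin 2) :
    Measurable (crossDirection f ν) := by
  unfold crossDirection
  split_ifs
  · exact measurable_const
  · have := Complex.measurable_ofReal
    exact (WithLp.measurable_toLp 2 (ℂ × ℂ)).comp (by fun_prop)

theorem memLp_brownianKernel_smul {f : ℝ → ℂ} (hf : Measurable f)
    (hbd : ∀ᵐ l : ℝ, ‖f l‖ ≤ 1) (ν : Fin 2) (t : ℝ) :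
    MemLp (fun l => brownianKernel t l • crossDirection f ν l) 2 := by
  refine (memLp_brownianKernel t).of_le ?_ ?_
  · exact (measurable_brownianKernel t).aestronglyMeasurable.smul
      (measurable_crossDirection hf ν).aestronglyMeasurable
  · filter_upwards [hbd] with l hl
    rw [norm_smul, norm_crossDirection hl, mul_one]

/-- The spectral representation, in a real Hilbert space, of the value at time `t`
of the component `ν`. -/
def spectralVector {f : ℝ → ℂ} (hf : Measurable f) (hbd : ∀ᵐ l : ℝ, ‖f l‖ ≤ 1)
    (ν : Fin 2) (t : ℝ) : Lp (WithLp 2 (ℂ × ℂ)) 2 (volume : Measure ℝ) :=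
  (memLp_brownianKernel_smul hf hbd ν t).toLp

section spectralVector

variable {f : ℝ → ℂ} (hf : Measurable f) (hbd : ∀ᵐ l : ℝ, ‖f l‖ ≤ 1)

theorem spectralVector_zero (ν : Fin 2) : spectralVector hf hbd ν 0 = 0 := by
  refine (Lp.eq_zero_iff_ae_eq_zero).2 ((MemLp.coeFn_toLp _).trans ?_)
  exact Filter.Eventually.of_forall fun l => by simp [brownianKernel_zero]

theorem inner_spectralVector_sub (ν ν' : Fin 2) (t s t' s' : ℝ) :
    inner ℝ (spectralVector hf hbd ν t - spectralVector hf hbd ν s)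
      (spectralVector hf hbd ν' t' - spectralVector hf hbd ν' s') =
    ∫ l : ℝ, inner ℝ ((brownianKernel t l - brownianKernel s l) • crossDirection f ν l)
      ((brownianKernel t' l - brownianKernel s' l) • crossDirection f ν' l) := by
  have h : ∀ ν t s, (spectralVector hf hbd ν t - spectralVector hf hbd ν s :
      Lp (WithLp 2 (ℂ × ℂ)) 2 (volume : Measure ℝ)) =ᵐ[volume]
      fun l => (brownianKernel t l - brownianKernel s l) • crossDirection f ν l := fun ν t s => by
    filter_upwards [Lp.coeFn_sub (spectralVector hf hbd ν t) (spectralVector hf hbd ν s),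
      (memLp_brownianKernel_smul hf hbd ν t).coeFn_toLp,
      (memLp_brownianKernel_smul hf hbd ν s).coeFn_toLp] with l h1 h2 h3
    rw [h1, Pi.sub_apply, spectralVector, spectralVector, h2, h3, sub_smul]
  rw [L2.inner_def]
  refine integral_congr_ae ?_
  filter_upwards [h ν t s, h ν' t' s'] with l h1 h2
  rw [h1, h2]

theorem inner_prod_smul_smul (a b : ℂ) (x y : WithLp 2 (ℂ × ℂ)) :
    inner ℝ (a • x) (b • y) = ((starRingEnd ℂ) a * b *
      ((starRingEnd ℂ) x.fst * y.fst + (starRingEnd ℂ) x.snd * y.snd)).re := by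
  simp only [WithLp.prod_inner_apply, WithLp.ofLp_smul, Prod.smul_fst, Prod.smul_snd, WithLp.fst,
    WithLp.snd, Complex.inner, smul_eq_mul, map_mul, ← Complex.add_re]
  ring_nf

theorem inner_spectralVector_add_sub_add (ν ν' : Fin 2) (t s t' s' h : ℝ) :
    inner ℝ (spectralVector hf hbd ν (t + h) - spectralVector hf hbd ν (s + h))
      (spectralVector hf hbd ν' (t' + h) - spectralVector hf hbd ν' (s' + h)) =
    inner ℝ (spectralVector hf hbd ν t - spectralVector hf hbd ν s)
      (spectralVector hf hbd ν' t' - spectralVector hf hbd ν' s') := by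
  rw [inner_spectralVector_sub, inner_spectralVector_sub]
  refine integral_congr_ae (Filter.Eventually.of_forall fun l => ?_)
  simp only [inner_prod_smul_smul, brownianKernel_add_sub_add _ _ h]
  rw [map_mul, mul_mul_mul_comm, ← Complex.normSq_eq_conj_mul_self, Complex.normSq_eq_norm_sq,
    Complex.norm_exp_I_mul_ofReal]
  simp

theorem norm_spectralVector_sub_sq (ν : Fin 2) (t s : ℝ) :
    ‖spectralVector hf hbd ν t - spectralVector hf hbd ν s‖ ^ 2 = |t - s| := by
  rw [← real_inner_self_eq_norm_sq, inner_spectralVector_sub]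
  have : ∫ l : ℝ, inner ℝ ((brownianKernel t l - brownianKernel s l) • crossDirection f ν l)
      ((brownianKernel t l - brownianKernel s l) • crossDirection f ν l) =
      ∫ l : ℝ, Real.pi⁻¹ * ((1 - Real.cos ((t - s) * l)) / l ^ 2) := by
    refine integral_congr_ae ?_
    filter_upwards [hbd] with l hl
    rw [real_inner_self_eq_norm_sq, norm_smul, norm_crossDirection hl, mul_one,
      norm_brownianKernel_sub_sq]
  rw [this, integral_const_mul, integral_one_sub_cos_div_sq]
  field_simp

theorem inner_spectralVector (ν : Fin 2) (t s : ℝ) :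
    inner ℝ (spectralVector hf hbd ν t) (spectralVector hf hbd ν s) =
      (|t| + |s| - |t - s|) / 2 := by
  have h : ∀ t, ‖spectralVector hf hbd ν t‖ ^ 2 = |t| := fun t => by
    simpa [spectralVector_zero] using norm_spectralVector_sub_sq hf hbd ν t 0
  have h1 := norm_sub_sq_real (spectralVector hf hbd ν t) (spectralVector hf hbd ν s)
  rw [norm_spectralVector_sub_sq, h, h] at h1
  linarith

theorem inner_spectralVector_cross (hsym : ∀ᵐ l : ℝ, (starRingEnd ℂ) (f l) = f (-l))
    (t s t' s' : ℝ) :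
    ((inner ℝ (spectralVector hf hbd 0 t - spectralVector hf hbd 0 s)
      (spectralVector hf hbd 1 t' - spectralVector hf hbd 1 s') : ℝ) : ℂ) =
    (1 / (2 * (Real.pi : ℂ))) *
        ∫ l : ℝ,
          (Complex.exp (-(Complex.I * l * s)) - Complex.exp (-(Complex.I * l * t))) *
            (Complex.exp (Complex.I * l * s') - Complex.exp (Complex.I * l * t')) /
              ((l : ℂ) ^ 2) * f l := by
  let g : ℝ → ℂ := fun l => (brownianKernel t l - brownianKernel s l) *
    (starRingEnd ℂ) (brownianKernel t' l - brownianKernel s' l) * f l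
  have hconj : ∀ l u : ℝ, (starRingEnd ℂ) (Complex.exp (-(Complex.I * l * u))) =
      Complex.exp (Complex.I * l * u) := fun l u => by
    rw [← Complex.exp_conj]
    simp
  have hg : ∀ l : ℝ, g l = (1 / (2 * (Real.pi : ℂ))) *
      ((Complex.exp (-(Complex.I * l * s)) - Complex.exp (-(Complex.I * l * t))) *
        (Complex.exp (Complex.I * l * s') - Complex.exp (Complex.I * l * t')) /
          ((l : ℂ) ^ 2) * f l) := fun l => by
    have h2 : ((Real.sqrt (2 * Real.pi) : ℝ) : ℂ) * ((Real.sqrt (2 * Real.pi) : ℝ) : ℂ) =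
        2 * (Real.pi : ℂ) := by
      rw [← Complex.ofReal_mul, Real.mul_self_sqrt (by positivity)]
      push_cast
      ring
    simp only [g, brownianKernel_sub, map_div₀, map_sub, Complex.conj_ofReal, hconj]
    rw [div_div, div_div, div_mul_div_comm, mul_mul_mul_comm, h2]
    ring
  have hint : Integrable g := by
    have h1 : ∀ t s, MemLp (fun l => brownianKernel t l - brownianKernel s l) 2 := fun t s =>
      (memLp_brownianKernel t).sub (memLp_brownianKernel s)
    have h2 : Integrable fun l => (brownianKernel t l - brownianKernel s l) *
        (starRingEnd ℂ) (brownianKernel t' l - brownianKernel s' l) :=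
      (h1 t s).integrable_mul (h1 t' s').star
    exact h2.mul_bdd (c := 1) hf.aestronglyMeasurable hbd
  rw [← integral_const_mul, ← integral_congr_ae (Filter.Eventually.of_forall hg),
    inner_spectralVector_sub]
  have hre : ∀ l, inner ℝ ((brownianKernel t l - brownianKernel s l) • crossDirection f 0 l)
      ((brownianKernel t' l - brownianKernel s' l) • crossDirection f 1 l) = (g l).re := fun l => by
    rw [inner_prod_smul_smul, ← Complex.conj_re]
    simp [crossDirection, g]
  simp_rw [hre]
  have h1 := integral_re hint
  simp only [RCLike.re_to_complex] at h1
  rw [h1, ← Complex.conj_eq_iff_re, ← integral_conj, ← integral_neg_eq_self]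
  refine integral_congr_ae ?_
  have hsym' := (Measure.measurePreserving_neg (volume : Measure ℝ)).quasiMeasurePreserving.ae hsym
  filter_upwards [hsym'] with l hl
  simp only [hg, map_mul, map_div₀, map_sub, hl, neg_neg, Complex.ofReal_neg, map_pow,
    Complex.conj_ofReal, ← Complex.exp_conj]
  simp
  exact Or.inl (map_ofNat _ 2)

end spectralVector

theorem lintegral_enorm_pow_four_of_map_eq_gaussianReal {Ω : Type*} [MeasurableSpace Ω]
    {P : Measure Ω} {X : Ω → ℝ} (hX : AEMeasurable X P) {v : NNReal}
    (h : P.map X = gaussianReal 0 v) :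
    ∫⁻ ω, ‖X ω‖ₑ ^ 4 ∂P =
      (∫⁻ x, ‖x‖ₑ ^ 4 ∂(gaussianReal 0 1)) * ENNReal.ofReal ((v : ℝ) ^ 2) := by
  have hm : Measurable fun x : ℝ => ‖x‖ₑ ^ 4 := by fun_prop
  have hv : gaussianReal 0 v = (gaussianReal 0 1).map (Real.sqrt v * ·) := by
    rw [gaussianReal_map_const_mul]
    congr 1
    · simp
    · ext
      simp
  have h1 : ‖Real.sqrt v‖ₑ ^ 4 = ENNReal.ofReal ((v : ℝ) ^ 2) := by
    rw [Real.enorm_eq_ofReal (Real.sqrt_nonneg _), ← ENNReal.ofReal_pow (Real.sqrt_nonneg _),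
      show 4 = 2 * 2 from rfl, pow_mul, Real.sq_sqrt v.coe_nonneg]
  rw [← lintegral_map' (f := fun x : ℝ => ‖x‖ₑ ^ 4) hm.aemeasurable hX, h, hv,
    lintegral_map hm (by fun_prop)]
  simp only [enorm_mul, mul_pow, h1]
  rw [lintegral_const_mul _ hm, mul_comm]

theorem lintegral_enorm_pow_four_gaussianReal_ne_top :
    ∫⁻ x, ‖x‖ₑ ^ 4 ∂(gaussianReal 0 1) ≠ ⊤ := by
  have h := memLp_id_gaussianReal (μ := 0) (v := 1) 4
  have h2 := lintegral_rpow_enorm_lt_top_of_eLpNorm_lt_top (by norm_num) (by norm_num) h.2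
  refine ne_of_lt (lt_of_le_of_lt (le_of_eq ?_) h2)
  refine lintegral_congr fun x => ?_
  simp

section isonormal

variable {H Ω : Type*} [NormedAddCommGroup H] [InnerProductSpace ℝ H] [MeasurableSpace Ω]
  {P : Measure Ω} (W : H →ₗᵢ[ℝ] Lp ℝ 2 P)

theorem integral_mul_eq_inner {X Y : Ω → ℝ} {h k : H} (hX : X =ᵐ[P] W h) (hY : Y =ᵐ[P] W k) :
    ∫ ω, X ω * Y ω ∂P = inner ℝ h k := by
  rw [← W.inner_map_map, L2.inner_def]
  refine integral_congr_ae ?_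
  filter_upwards [hX, hY] with ω h1 h2
  rw [h1, h2]
  simp [mul_comm]

theorem ae_sub_eq {X Y : Ω → ℝ} {h k : H} (hX : X =ᵐ[P] W h) (hY : Y =ᵐ[P] W k) :
    (fun ω => X ω - Y ω) =ᵐ[P] W (h - k) := by
  rw [map_sub]
  filter_upwards [hX, hY, Lp.coeFn_sub (W h) (W k)] with ω h1 h2 h3
  rw [h1, h2, h3, Pi.sub_apply]

theorem ae_sum_eq {n : ℕ} (c : Fin n → ℝ) {X : Fin n → Ω → ℝ} {h : Fin n → H}
    (hX : ∀ i, X i =ᵐ[P] W (h i)) :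
    (fun ω => ∑ i, c i * X i ω) =ᵐ[P] W (∑ i, c i • h i) := by
  simp only [map_sum, map_smul]
  have h1 := ae_all_iff.2 hX
  have h2 := ae_all_iff.2 fun i => Lp.coeFn_smul (c i) (W (h i))
  filter_upwards [h1, h2, Lp.coeFn_finsetSum Finset.univ fun i => c i • W (h i)] with ω h1 h2 h3
  rw [h3, Finset.sum_apply]
  refine Finset.sum_congr rfl fun i _ => ?_
  rw [h1, h2, Pi.smul_apply, smul_eq_mul]

theorem isGaussianRV_of_ae_eq (hW : ∀ h, P.map (W h) = gaussianReal 0 (‖h‖₊ ^ 2))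
    {X : Ω → ℝ} {h : H} (hX : X =ᵐ[P] W h) : IsGaussianRV P X :=
  ⟨0, ‖h‖₊ ^ 2, (Measure.map_congr hX).trans (hW h)⟩

theorem integral_eq_zero_of_ae_eq (hW : ∀ h, P.map (W h) = gaussianReal 0 (‖h‖₊ ^ 2))
    {X : Ω → ℝ} {h : H} (hX : X =ᵐ[P] W h) :
    ∫ ω, X ω ∂P = 0 := by
  have hm := (Lp.aestronglyMeasurable (W h)).aemeasurable
  rw [integral_congr_ae hX, ← integral_map (f := fun x : ℝ => x) hm (by fun_prop), hW,
    integral_id_gaussianReal]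

/-- An isonormal process along a curve with `‖V t - V s‖² = |t - s|` has a continuous
modification. -/
theorem exists_continuous_version (hW : ∀ h, P.map (W h) = gaussianReal 0 (‖h‖₊ ^ 2))
    {V : ℝ → H} (hV : ∀ t s, ‖V t - V s‖ ^ 2 = |t - s|) :
    ∃ Y : ℝ → Ω → ℝ, (∀ ω, Continuous fun t => Y t ω) ∧ ∀ t, Y t =ᵐ[P] W (V t) := by
  have hm : ∀ h, AEMeasurable (W h) P := fun h => (Lp.aestronglyMeasurable (W h)).aemeasurable
  refine exists_continuous_modification (X := fun t => W (V t))
    (K := (∫⁻ x, ‖x‖ₑ ^ 4 ∂(gaussianReal 0 1)).toNNReal) (fun t => hm _) fun s t => ?_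
  have hae := ae_sub_eq W (Filter.EventuallyEq.refl _ (W (V s)))
    (Filter.EventuallyEq.refl _ (W (V t)))
  rw [ENNReal.coe_toNNReal lintegral_enorm_pow_four_gaussianReal_ne_top,
    lintegral_congr_ae (hae.mono fun ω h => congrArg (‖·‖ₑ ^ 4) h),
    lintegral_enorm_pow_four_of_map_eq_gaussianReal (hm _) (hW _)]
  simp [hV]

theorem isTwoSidedStdBM_of_ae_eq (hW : ∀ h, P.map (W h) = gaussianReal 0 (‖h‖₊ ^ 2))
    {V : ℝ → H} {B : ℝ → Ω → ℝ}
    (hV : ∀ t s, inner ℝ (V t) (V s) = (|t| + |s| - |t - s|) / 2)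
    (hB : ∀ t, B t =ᵐ[P] W (V t)) (hcont : ∀ ω, Continuous fun t => B t ω)
    (hzero : ∀ ω, B 0 ω = 0) : IsTwoSidedStdBM P B := by
  refine ⟨fun n c t => ?_, fun t => ?_, hcont, hzero, fun t s => ?_⟩
  · exact isGaussianRV_of_ae_eq W hW (ae_sum_eq W c fun i => hB (t i))
  · exact integral_eq_zero_of_ae_eq W hW (hB t)
  · rw [integral_mul_eq_inner W (hB t) (hB s), hV]

end isonormal

theorem statement0 (f : ℝ → ℂ) (hf_meas : Measurable f)
    (hf_bd : ∀ᵐ l : ℝ, ‖f l‖ ≤ 1)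
    (hf_sym : ∀ᵐ l : ℝ, (starRingEnd ℂ) (f l) = f (-l)) :
    ∃ (Ω : Type) (mΩ : MeasurableSpace Ω) (μ : Measure Ω) (_ : IsProbabilityMeasure μ)
      (B : Fin 2 → ℝ → Ω → ℝ),
      IsGaussianProcess μ B ∧ HasStationaryIncrements μ B ∧
      IsTwoSidedStdBM μ (B 0) ∧ IsTwoSidedStdBM μ (B 1) ∧
      IsCrossSpectralDensity μ (B 0) (B 1) f := by
  obtain ⟨Ω, _, P, hP, W, hW⟩ := exists_isonormal (Lp (WithLp 2 (ℂ × ℂ)) 2 (volume : Measure ℝ))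
  choose Y hYcont hY using fun ν => exists_continuous_version W hW
    (norm_spectralVector_sub_sq hf_meas hf_bd ν)
  let B : Fin 2 → ℝ → Ω → ℝ := fun ν t ω => Y ν t ω - Y ν 0 ω
  have hB : ∀ ν t, B ν t =ᵐ[P] W (spectralVector hf_meas hf_bd ν t) := fun ν t => by
    simpa [spectralVector_zero] using ae_sub_eq W (hY ν t) (hY ν 0)
  have hBM : ∀ ν, IsTwoSidedStdBM P (B ν) := fun ν =>
    isTwoSidedStdBM_of_ae_eq W hW (inner_spectralVector hf_meas hf_bd ν) (hB ν)
      (fun ω => (hYcont ν ω).sub continuous_const) fun ω => sub_self _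
  refine ⟨Ω, _, P, hP, B, fun n c ν t => ?_, fun ν ν' t₁ s₁ t₂ s₂ h => ?_, hBM 0, hBM 1,
    fun s t s' t' _ _ => ?_⟩
  · exact isGaussianRV_of_ae_eq W hW (ae_sum_eq W c fun i => hB (ν i) (t i))
  · rw [integral_mul_eq_inner W (ae_sub_eq W (hB ν _) (hB ν _)) (ae_sub_eq W (hB ν' _) (hB ν' _)),
      integral_mul_eq_inner W (ae_sub_eq W (hB ν _) (hB ν _)) (ae_sub_eq W (hB ν' _) (hB ν' _)),
      inner_spectralVector_add_sub_add]
  · rw [integral_mul_eq_inner W (ae_sub_eq W (hB 0 _) (hB 0 _)) (ae_sub_eq W (hB 1 _) (hB 1 _)),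
      inner_spectralVector_cross hf_meas hf_bd hf_sym]

end
end

section
/- Let B = (B¹_t, B²_t)_{t∈ℝ} be a bivariate process with stationary increments such that both B¹ and B² are two-sided standard Brownian motions. Then there exists a measurable function f: ℝ → ℂ with |f(λ)| ≤ 1 for almost every λ and conj(f(λ)) = f(−λ) for almost every λ, such that f is a cross-spectral density of B, i.e. for all reals s < t and s' < t', E[(B¹_t − B¹_s)(B²_{t'} − B²_{s'})] = (1/(2π)) ∫_ℝ ((e^{−iλs} − e^{−iλt})(e^{iλs'} − e^{iλt'})/λ²) f(λ) dλ. -/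
open MeasureTheory ProbabilityTheory

noncomputable section

open scoped FourierTransform SchwartzMap

theorem integral_fourier_schwartz_smul (φ : 𝓢(ℝ, ℂ)) {w : ℝ → ℂ} (hw : Integrable w) :
    ∫ x, (𝓕 φ) x • w x = ∫ x, φ x • 𝓕 w x := by
  have h := VectorFourier.integral_fourierIntegral_smul_eq_flip (L := innerₗ ℝ)
    (f := φ) (g := w) (μ := volume) (ν := volume) Real.continuous_fourierChar
    continuous_inner φ.integrable hw
  rw [flip_innerₗ] at h
  rw [SchwartzMap.fourier_coe]
  exact h

open scoped ContDiff in
/-- An integrable function whose Fourier transform vanishes is zero almost everywhere. -/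
theorem ae_eq_zero_of_fourier_eq_zero {w : ℝ → ℂ} (hw : Integrable w) (h : ∀ x, 𝓕 w x = 0) :
    ∀ᵐ x, w x = 0 := by
  refine ae_eq_zero_of_integral_contDiff_smul_eq_zero hw.locallyIntegrable fun g hg hc => ?_
  have hc' : HasCompactSupport (Complex.ofRealCLM ∘ g) := hc.comp_left rfl
  have hg' : ContDiff ℝ ∞ (Complex.ofRealCLM ∘ g) := by fun_prop
  have := integral_fourier_schwartz_smul (𝓕⁻ (hc'.toSchwartzMap hg')) hw
  simpa [h] using this

open scoped ContDiff in
/-- On integrable elements, the `L²` Fourier transform is given by the Fourier integral. -/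
theorem coeFn_fourier_ae_eq (f : Lp ℂ 2 (volume : Measure ℝ)) (hf : Integrable f) :
    ∀ᵐ x, (𝓕 f : Lp ℂ 2 (volume : Measure ℝ)) x = 𝓕 (f : ℝ → ℂ) x := by
  have hcont : Continuous (𝓕 (f : ℝ → ℂ)) :=
    VectorFourier.fourierIntegral_continuous Real.continuous_fourierChar
      (by exact continuous_inner) hf
  refine ae_eq_of_integral_contDiff_smul_eq
    ((Lp.memLp (𝓕 f)).locallyIntegrable (by norm_num)) hcont.locallyIntegrable fun g hg hc => ?_
  have hc' : HasCompactSupport (Complex.ofRealCLM ∘ g) := hc.comp_left rfl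
  have hg' : ContDiff ℝ ∞ (Complex.ofRealCLM ∘ g) := by fun_prop
  have h1 := integral_fourier_schwartz_smul (hc'.toSchwartzMap hg') hf
  have h2 := DFunLike.congr_fun (Lp.fourier_toTemperedDistribution_eq f) (hc'.toSchwartzMap hg')
  rw [TemperedDistribution.fourier_apply, Lp.toTemperedDistribution_apply,
    Lp.toTemperedDistribution_apply, h1] at h2
  simpa using h2.symm

/-- A family with the same Gram matrix as a total family is its image under a contraction. -/
theorem exists_contraction_of_inner_eq {ι H K : Type*}
    [NormedAddCommGroup H] [InnerProductSpace ℂ H]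
    [NormedAddCommGroup K] [InnerProductSpace ℂ K] [CompleteSpace K] (b : ι → H) (c : ι → K)
    (hb : Dense (Submodule.span ℂ (Set.range b) : Set H))
    (h : ∀ i j, inner ℂ (c i) (c j) = inner ℂ (b i) (b j)) :
    ∃ J : H →L[ℂ] K, ‖J‖ ≤ 1 ∧ ∀ i, J (b i) = c i := by
  have hnorm (x : ι →₀ ℂ) :
      ‖Finsupp.linearCombination ℂ c x‖ ≤ 1 * ‖Finsupp.linearCombination ℂ b x‖ := by
    have : inner ℂ (Finsupp.linearCombination ℂ c x) (Finsupp.linearCombination ℂ c x) =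
        inner ℂ (Finsupp.linearCombination ℂ b x) (Finsupp.linearCombination ℂ b x) := by
      simp only [Finsupp.linearCombination_apply, Finsupp.sum, sum_inner, inner_sum,
        inner_smul_left, inner_smul_right, h]
    rw [one_mul, norm_eq_sqrt_re_inner (𝕜 := ℂ), this, ← norm_eq_sqrt_re_inner (𝕜 := ℂ)]
  have hd : DenseRange (Finsupp.linearCombination ℂ b) := by
    rw [DenseRange, ← LinearMap.coe_range, Finsupp.range_linearCombination]
    exact hb
  refine ⟨(Finsupp.linearCombination ℂ c).extendOfNorm (Finsupp.linearCombination ℂ b),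
    LinearMap.opNorm_extendOfNorm_le hd zero_le_one hnorm, fun i => ?_⟩
  have := LinearMap.extendOfNorm_eq hd ⟨1, hnorm⟩ (Finsupp.single i 1)
  simpa using this

/-- The signed indicator function of the interval between `0` and `t`. -/
def signedInterval (t : ℝ) : Lp ℂ 2 (volume : Measure ℝ) :=
  indicatorConstLp 2 (measurableSet_Ioc (a := 0) (b := t)) measure_Ioc_lt_top.ne 1 -
    indicatorConstLp 2 (measurableSet_Ioc (a := t) (b := 0)) measure_Ioc_lt_top.ne 1

theorem signedInterval_ae_eq (t : ℝ) : (signedInterval t : ℝ → ℂ) =ᵐ[volume]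
    fun x => (Set.Ioc 0 t).indicator (fun _ => 1) x - (Set.Ioc t 0).indicator (fun _ => 1) x := by
  filter_upwards [Lp.coeFn_sub
    (indicatorConstLp 2 (measurableSet_Ioc (a := 0) (b := t)) measure_Ioc_lt_top.ne (1 : ℂ))
    (indicatorConstLp 2 (measurableSet_Ioc (a := t) (b := 0)) measure_Ioc_lt_top.ne (1 : ℂ)),
    indicatorConstLp_coeFn (p := 2) (hs := measurableSet_Ioc (a := 0) (b := t))
      (hμs := measure_Ioc_lt_top.ne) (c := (1 : ℂ)),
    indicatorConstLp_coeFn (p := 2) (hs := measurableSet_Ioc (a := t) (b := 0))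
      (hμs := measure_Ioc_lt_top.ne) (c := (1 : ℂ))] with x h1 h2 h3
  rw [signedInterval, h1, Pi.sub_apply, h2, h3]

theorem inner_signedInterval (t s : ℝ) :
    inner ℂ (signedInterval t) (signedInterval s) = (((|t| + |s| - |t - s|) / 2 : ℝ) : ℂ) := by
  simp only [signedInterval, inner_sub_left, inner_sub_right,
    L2.inner_indicatorConstLp_one_indicatorConstLp_one, Set.Ioc_inter_Ioc, Real.volume_real_Ioc]
  have h : max (min t s - max 0 0) 0 - max (min 0 s - max t 0) 0 -
      (max (min t 0 - max 0 s) 0 - max (min 0 0 - max t s) 0) = (|t| + |s| - |t - s|) / 2 := by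
    rcases abs_cases t with ⟨h1, _⟩ | ⟨h1, _⟩ <;> rcases abs_cases s with ⟨h2, _⟩ | ⟨h2, _⟩ <;>
      rcases abs_cases (t - s) with ⟨h3, _⟩ | ⟨h3, _⟩ <;> rw [h1, h2, h3] <;> grind
  rw [← h]
  push_cast
  rfl

theorem inner_signedInterval_left (t : ℝ) (f : Lp ℂ 2 (volume : Measure ℝ)) :
    inner ℂ (signedInterval t) f = ∫ x in (0 : ℝ)..t, f x := by
  rw [signedInterval, inner_sub_left, L2.inner_indicatorConstLp_one, L2.inner_indicatorConstLp_one,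
    intervalIntegral]

theorem dense_span_signedInterval :
    Dense (Submodule.span ℂ (Set.range signedInterval) : Set (Lp ℂ 2 (volume : Measure ℝ))) := by
  rw [Submodule.dense_iff_topologicalClosure_eq_top, Submodule.topologicalClosure_eq_top_iff,
    Submodule.eq_bot_iff]
  intro f hf
  have h0 (t : ℝ) : ∫ x in (0 : ℝ)..t, f x = 0 := by
    rw [← inner_signedInterval_left]
    exact (Submodule.mem_orthogonal _ f).1 hf _ (Submodule.subset_span ⟨t, rfl⟩)
  rw [Lp.eq_zero_iff_ae_eq_zero]
  filter_upwards [LocallyIntegrable.ae_hasDerivAt_integral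
    ((Lp.memLp f).locallyIntegrable (by norm_num))] with x hx
  have := hx 0
  simp only [h0] at this
  exact this.unique (hasDerivAt_const x 0)

/-- The `L²` Fourier transform of `signedInterval t`. -/
def spectralInterval (t : ℝ) : Lp ℂ 2 (volume : Measure ℝ) :=
  𝓕 (signedInterval t)

theorem inner_spectralInterval (t s : ℝ) :
    inner ℂ (spectralInterval t) (spectralInterval s) =
      (((|t| + |s| - |t - s|) / 2 : ℝ) : ℂ) := by
  rw [spectralInterval, spectralInterval, Lp.inner_fourier_eq, inner_signedInterval]

theorem spectralInterval_zero : spectralInterval 0 = 0 := by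
  have := inner_spectralInterval 0 0
  simpa using this

theorem dense_span_spectralInterval :
    Dense (Submodule.span ℂ (Set.range spectralInterval) : Set (Lp ℂ 2 (volume : Measure ℝ))) := by
  have h := (Lp.fourierTransformₗᵢ ℝ ℂ).surjective.denseRange.dense_image
    (Lp.fourierTransformₗᵢ ℝ ℂ).continuous dense_span_signedInterval
  convert h
  have := congrArg (fun S : Submodule ℂ (Lp ℂ 2 (volume : Measure ℝ)) =>
      (S : Set (Lp ℂ 2 (volume : Measure ℝ))))
    (Submodule.map_span (Lp.fourierTransformₗᵢ ℝ ℂ).toLinearEquiv.toLinearMap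
      (Set.range signedInterval))
  rw [← Set.range_comp] at this
  exact this.symm

theorem spectralInterval_ae_eq (t : ℝ) : ∀ᵐ x, (spectralInterval t : ℝ → ℂ) x =
    (1 - Complex.exp (-(2 * Real.pi * Complex.I * x * t))) / (2 * Real.pi * Complex.I * x) := by
  have hi : Integrable (fun x : ℝ => (Set.Ioc 0 t).indicator (fun _ => (1 : ℂ)) x -
      (Set.Ioc t 0).indicator (fun _ => 1) x) :=
    ((integrable_indicator_iff measurableSet_Ioc).2 (by simp)).sub
      ((integrable_indicator_iff measurableSet_Ioc).2 (by simp))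
  have hn : ∀ᵐ x : ℝ, x ≠ 0 := by simp [ae_iff]
  filter_upwards [coeFn_fourier_ae_eq (signedInterval t)
    (hi.congr (signedInterval_ae_eq t).symm), hn] with x hx hx0
  have hc : -(2 * Real.pi * Complex.I * x) ≠ 0 := by
    simp [hx0, Real.pi_ne_zero]
  rw [spectralInterval, hx, Real.fourier_real_eq_integral_exp_smul]
  have h1 : ∀ s : Set ℝ, MeasurableSet s →
      ∫ v : ℝ, s.indicator (fun y : ℝ => Complex.exp (-(2 * Real.pi * Complex.I * x) * y)) v =
      ∫ v in s, Complex.exp (-(2 * Real.pi * Complex.I * x) * v) :=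
    fun s hs => integral_indicator hs
  have h2 : ∀ a b : ℝ, Integrable ((Set.Ioc a b).indicator
      (fun y : ℝ => Complex.exp (-(2 * Real.pi * Complex.I * x) * y))) := fun a b =>
    (integrable_indicator_iff measurableSet_Ioc).2
      (Continuous.integrableOn_Ioc (by fun_prop))
  calc _ = ∫ v : ℝ, ((Set.Ioc 0 t).indicator
          (fun y : ℝ => Complex.exp (-(2 * Real.pi * Complex.I * x) * y)) v -
        (Set.Ioc t 0).indicator
          (fun y : ℝ => Complex.exp (-(2 * Real.pi * Complex.I * x) * y)) v) := by
        refine integral_congr_ae ?_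
        filter_upwards [signedInterval_ae_eq t] with v hv
        rw [hv, smul_eq_mul, mul_sub]
        have : Complex.exp (↑(-2 * Real.pi * v * x) * Complex.I) =
            Complex.exp (-(2 * Real.pi * Complex.I * x) * v) := by
          congr 1; push_cast; ring
        rw [this]
        congr 1 <;> simp only [Set.indicator_apply] <;> split_ifs <;> simp
    _ = ∫ v in (0 : ℝ)..t, Complex.exp (-(2 * Real.pi * Complex.I * x) * v) := by
        rw [integral_sub (h2 _ _) (h2 _ _), h1 _ measurableSet_Ioc, h1 _ measurableSet_Ioc,
          intervalIntegral]
    _ = _ := by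
        rw [integral_exp_mul_complex hc]
        have : (-(2 * Real.pi * Complex.I * x) * t : ℂ) =
          -(2 * Real.pi * Complex.I * x * t) := by ring
        rw [this]
        simp only [Complex.ofReal_zero, mul_zero, Complex.exp_zero]
        rw [div_neg, ← neg_div, neg_sub]


/-- Shifting in time multiplies the spectral representation by a character. -/
theorem spectralInterval_shift_ae_eq (t s h : ℝ) :
    ∀ᵐ x, (spectralInterval (t + h) - spectralInterval (s + h) : Lp ℂ 2 (volume : Measure ℝ)) x =
      Complex.exp (-(2 * Real.pi * Complex.I * x * h)) *
        (spectralInterval t - spectralInterval s : Lp ℂ 2 (volume : Measure ℝ)) x := by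
  filter_upwards [Lp.coeFn_sub (spectralInterval (t + h)) (spectralInterval (s + h)),
    Lp.coeFn_sub (spectralInterval t) (spectralInterval s), spectralInterval_ae_eq (t + h),
    spectralInterval_ae_eq (s + h), spectralInterval_ae_eq t, spectralInterval_ae_eq s]
    with x h1 h2 h3 h4 h5 h6
  rw [h1, h2, Pi.sub_apply, Pi.sub_apply, h3, h4, h5, h6, Complex.ofReal_add, Complex.ofReal_add]
  simp only [mul_add, neg_add, Complex.exp_add]
  ring

theorem norm_exp_character (x h : ℝ) :
    ‖Complex.exp (-(2 * Real.pi * Complex.I * x * h))‖ = 1 := by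
  have : (-(2 * Real.pi * Complex.I * x * h) : ℂ) = ((-(2 * Real.pi * x * h) : ℝ) : ℂ) *
    Complex.I := by push_cast; ring
  rw [this, Complex.norm_exp_ofReal_mul_I]

theorem conj_exp_character (x h : ℝ) :
    (starRingEnd ℂ) (Complex.exp (-(2 * Real.pi * Complex.I * x * h))) =
      Complex.exp (-(2 * Real.pi * Complex.I * x * (-h : ℝ))) := by
  rw [← Complex.exp_conj]
  congr 1
  simp [Complex.conj_ofNat]

/-- A square-integrable function multiplied by a character, as an element of `L²`. -/
theorem exists_character_mul (g : Lp ℂ 2 (volume : Measure ℝ)) (h : ℝ) :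
    ∃ w : Lp ℂ 2 (volume : Measure ℝ),
      ∀ᵐ x, w x = Complex.exp (-(2 * Real.pi * Complex.I * x * h)) * g x := by
  have hm : MemLp (fun x : ℝ => Complex.exp (-(2 * Real.pi * Complex.I * x * h)) * g x) 2 := by
    refine (Lp.memLp g).of_le ?_ (.of_forall fun x => ?_)
    · exact (Continuous.aestronglyMeasurable (by fun_prop)).mul (Lp.aestronglyMeasurable g)
    · rw [norm_mul, norm_exp_character, one_mul]
  exact ⟨hm.toLp, hm.coeFn_toLp⟩

theorem eq_of_inner_spectralInterval {f g : Lp ℂ 2 (volume : Measure ℝ)}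
    (h : ∀ t, inner ℂ f (spectralInterval t) = inner ℂ g (spectralInterval t)) : f = g := by
  have := dense_span_spectralInterval
  rw [Submodule.dense_iff_topologicalClosure_eq_top, Submodule.topologicalClosure_eq_top_iff,
    Submodule.eq_bot_iff] at this
  refine sub_eq_zero.1 (this (f - g) ?_)
  rw [Submodule.mem_orthogonal']
  intro u hu
  induction hu using Submodule.span_induction with
  | mem x hx =>
    obtain ⟨t, rfl⟩ := hx
    rw [inner_sub_left, h, sub_self]
  | zero => simp
  | add x y _ _ hx hy => rw [inner_add_right, hx, hy, add_zero]
  | smul a x _ hx => rw [inner_smul_right, hx, mul_zero]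

/-- An operator whose matrix on increments is shift invariant commutes with characters. -/
theorem map_spectralInterval_shift_ae_eq
    (N : Lp ℂ 2 (volume : Measure ℝ) →L[ℂ] Lp ℂ 2 (volume : Measure ℝ))
    (hN : ∀ t s t' s' h : ℝ,
      inner ℂ (N (spectralInterval (t + h) - spectralInterval (s + h)))
        (spectralInterval (t' + h) - spectralInterval (s' + h)) =
      inner ℂ (N (spectralInterval t - spectralInterval s))
        (spectralInterval t' - spectralInterval s')) (t s h : ℝ) :
    ∀ᵐ x, N (spectralInterval (t + h) - spectralInterval (s + h)) x =
      Complex.exp (-(2 * Real.pi * Complex.I * x * h)) *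
        N (spectralInterval t - spectralInterval s) x := by
  obtain ⟨w, hw⟩ := exists_character_mul (N (spectralInterval t - spectralInterval s)) h
  rw [eq_of_inner_spectralInterval (f := N (spectralInterval (t + h) - spectralInterval (s + h)))
    (g := w)]
  · exact hw
  intro t'
  have h1 := hN t s (t' - h) (-h) h
  rw [sub_add_cancel, neg_add_cancel, spectralInterval_zero, sub_zero] at h1
  rw [h1, L2.inner_def, L2.inner_def]
  refine integral_congr_ae ?_
  have h2 := spectralInterval_shift_ae_eq t' 0 (-h)
  rw [spectralInterval_zero, sub_zero, zero_add, ← sub_eq_add_neg] at h2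
  filter_upwards [hw, h2] with x hx hx'
  simp only [RCLike.inner_apply, hx, hx', map_mul, conj_exp_character]
  ring

theorem spectralInterval_one_ne_zero :
    ∀ᵐ x, (spectralInterval 1 : ℝ → ℂ) x ≠ 0 := by
  have hc : ∀ᵐ x : ℝ, x ∉ Set.range (fun n : ℤ => (n : ℝ)) :=
    (Set.countable_range _).ae_notMem _
  filter_upwards [spectralInterval_ae_eq 1, hc] with x hx hx'
  rw [hx]
  have h2 : (2 * Real.pi * Complex.I : ℂ) ≠ 0 := Complex.two_pi_I_ne_zero
  refine div_ne_zero (fun h => hx' ?_) (mul_ne_zero h2 ?_)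
  · rw [sub_eq_zero, eq_comm, Complex.exp_eq_one_iff] at h
    obtain ⟨n, hn⟩ := h
    refine ⟨-n, ?_⟩
    have h3 : (2 * Real.pi * Complex.I : ℂ) * x = (2 * Real.pi * Complex.I) * (-n) := by
      rw [Complex.ofReal_one, mul_one] at hn
      linear_combination -hn
    have h4 := mul_left_cancel₀ h2 h3
    push_cast
    exact_mod_cast h4.symm
  · rintro h
    exact hx' ⟨0, by simpa using (Complex.ofReal_eq_zero.1 h).symm⟩

theorem integrable_mul_conj (f g : Lp ℂ 2 (volume : Measure ℝ)) :
    Integrable (fun x => g x * (starRingEnd ℂ) (f x)) := by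
  simpa [RCLike.inner_apply] using L2.integrable_inner (𝕜 := ℂ) f g

/-- The adjoint of a contraction commuting with shifts is multiplication by a function bounded
by one. -/
theorem exists_multiplier
    (N : Lp ℂ 2 (volume : Measure ℝ) →L[ℂ] Lp ℂ 2 (volume : Measure ℝ)) (hN1 : ‖N‖ ≤ 1)
    (hN : ∀ t s t' s' h : ℝ,
      inner ℂ (N (spectralInterval (t + h) - spectralInterval (s + h)))
        (spectralInterval (t' + h) - spectralInterval (s' + h)) =
      inner ℂ (N (spectralInterval t - spectralInterval s))
        (spectralInterval t' - spectralInterval s')) :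
    ∃ m : ℝ → ℂ, Measurable m ∧ (∀ᵐ x, ‖m x‖ ≤ 1) ∧
      ∀ v : Lp ℂ 2 (volume : Measure ℝ), ∀ᵐ x, (N.adjoint v) x = m x * v x := by
  set u := spectralInterval 1
  set m : ℝ → ℂ := fun x => (starRingEnd ℂ) (N u x / u x)
  have hmeas : Measurable m := by
    have h1 := (Lp.stronglyMeasurable (N u)).measurable
    have h2 := (Lp.stronglyMeasurable u).measurable
    exact Complex.continuous_conj.measurable.comp (h1.div h2)
  have hmul (v : Lp ℂ 2 (volume : Measure ℝ)) : ∀ᵐ x, (N.adjoint v) x = m x * v x := by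
    have hz := ae_eq_zero_of_fourier_eq_zero
      ((integrable_mul_conj (N.adjoint v) u).sub (integrable_mul_conj v (N u))) fun h => ?_
    · filter_upwards [hz, spectralInterval_one_ne_zero] with x hx hx0
      have h1 : (starRingEnd ℂ) (N.adjoint v x) = N u x / u x * (starRingEnd ℂ) (v x) := by
        have hx0 : u x ≠ 0 := hx0
        have hx : u x * (starRingEnd ℂ) (N.adjoint v x) - N u x * (starRingEnd ℂ) (v x) = 0 := hx
        rw [div_mul_eq_mul_div, eq_div_iff hx0]
        linear_combination hx
      have h2 := congrArg (starRingEnd ℂ) h1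
      rwa [Complex.conj_conj, map_mul, Complex.conj_conj] at h2
    · have hadj := N.adjoint_inner_left (spectralInterval (1 + h) - spectralInterval (0 + h)) v
      rw [L2.inner_def, L2.inner_def] at hadj
      have hu0 : spectralInterval 1 - spectralInterval 0 = u := by
        rw [spectralInterval_zero, sub_zero]
      have e1 := spectralInterval_shift_ae_eq 1 0 h
      have e2 := map_spectralInterval_shift_ae_eq N hN 1 0 h
      rw [hu0] at e1 e2
      have hexp (x : ℝ) : Complex.exp (((-2 * Real.pi * x * h : ℝ) : ℂ) * Complex.I) =
          Complex.exp (-(2 * Real.pi * Complex.I * x * h)) := by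
        congr 1; push_cast; ring
      have hint (f g : Lp ℂ 2 (volume : Measure ℝ)) : Integrable (fun x : ℝ =>
          Complex.exp (-(2 * Real.pi * Complex.I * x * h)) *
            (g x * (starRingEnd ℂ) (f x))) := by
        refine (integrable_mul_conj f g).mono ?_ (.of_forall fun x => ?_)
        · exact (Continuous.aestronglyMeasurable (by fun_prop)).mul
            (integrable_mul_conj f g).aestronglyMeasurable
        · rw [norm_mul, norm_exp_character, one_mul]
      rw [Real.fourier_real_eq_integral_exp_smul]
      simp only [smul_eq_mul, hexp, Pi.sub_apply, mul_sub]
      rw [integral_sub (hint _ _) (hint _ _), sub_eq_zero]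
      convert hadj using 1
      · refine integral_congr_ae ?_
        filter_upwards [e1] with x hx
        rw [RCLike.inner_apply, hx]
        ring
      · refine integral_congr_ae ?_
        filter_upwards [e2] with x hx
        rw [RCLike.inner_apply, hx]
        ring
  refine ⟨m, hmeas, ?_, hmul⟩
  have hle : (fun x => ‖m x‖ₑ ^ 2) ≤ᵐ[volume] fun _ => 1 := by
    refine ae_le_of_forall_setLIntegral_le_of_sigmaFinite (hmeas.enorm.pow_const 2)
      fun s hs hs' => ?_
    set v := indicatorConstLp 2 hs hs'.ne (1 : ℂ) with hv
    have h1 : ‖N.adjoint v‖ ≤ ‖v‖ := by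
      refine (N.adjoint.le_opNorm v).trans ?_
      rw [LinearIsometryEquiv.norm_map]
      exact mul_le_of_le_one_left (norm_nonneg _) hN1
    have h2 := enorm_le_iff_norm_le.2 h1
    rw [Lp.enorm_def, Lp.enorm_def] at h2
    have h3 := ENNReal.rpow_le_rpow h2 (zero_le_two (α := ℝ))
    have h4 (f : ℝ → ℂ) := eLpNorm_nnreal_pow_eq_lintegral (f := f) (μ := volume)
      (p := 2) two_ne_zero
    simp only [NNReal.coe_ofNat, ENNReal.coe_ofNat, ENNReal.rpow_ofNat] at h3 h4
    rw [h4, h4] at h3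
    have h5 := indicatorConstLp_coeFn (p := 2) (hs := hs) (hμs := hs'.ne) (c := (1 : ℂ))
    rw [← lintegral_indicator hs, ← lintegral_indicator hs]
    convert h3 using 1
    · refine lintegral_congr_ae ?_
      filter_upwards [h5, hmul v] with x hx hx'
      rw [hx', hv, hx]
      by_cases hxs : x ∈ s <;> simp [hxs]
    · refine lintegral_congr_ae ?_
      filter_upwards [h5] with x hx
      rw [hv, hx]
      by_cases hxs : x ∈ s <;> simp [hxs]
  filter_upwards [hle] with x hx
  have hx1 : ‖m x‖ₑ ≤ 1 := by
    by_contra! hlt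
    exact absurd hx (not_le.2 (one_lt_pow₀ hlt two_ne_zero))
  rw [← ofReal_norm, ENNReal.ofReal_le_one] at hx1
  exact hx1

theorem IsTwoSidedStdBM.memLp {Ω : Type*} [MeasurableSpace Ω] {μ : Measure Ω} {W : ℝ → Ω → ℝ}
    (hW : IsTwoSidedStdBM μ W) (t : ℝ) : MemLp (W t) 2 μ := by
  obtain ⟨m, v, h⟩ := hW.1 1 (fun _ => 1) (fun _ => t)
  simp only [Finset.univ_unique, Finset.sum_singleton, one_mul] at h
  have hae : AEMeasurable (W t) μ := by
    by_contra hne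
    rw [Measure.map_of_not_aemeasurable hne] at h
    exact IsProbabilityMeasure.ne_zero (gaussianReal m v) h.symm
  have h2 := memLp_id_gaussianReal (μ := m) (v := v) 2
  rw [← h] at h2
  exact (memLp_map_measure_iff aestronglyMeasurable_id hae).1 h2

theorem IsTwoSidedStdBM.memLp_ofReal {Ω : Type*} [MeasurableSpace Ω] {μ : Measure Ω}
    {W : ℝ → Ω → ℝ} (hW : IsTwoSidedStdBM μ W) (t : ℝ) : MemLp (fun ω => (W t ω : ℂ)) 2 μ :=
  (hW.memLp t).ofReal

/-- Increments of square-integrable processes have covariance equal to their inner product. -/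
theorem inner_toLp_ofReal_sub {Ω : Type*} [MeasurableSpace Ω] {μ : Measure Ω} {X Y : ℝ → Ω → ℝ}
    (hX : ∀ t, MemLp (fun ω => (X t ω : ℂ)) 2 μ) (hY : ∀ t, MemLp (fun ω => (Y t ω : ℂ)) 2 μ)
    (t s t' s' : ℝ) :
    inner ℂ ((hX t).toLp - (hX s).toLp) ((hY t').toLp - (hY s').toLp) =
      ((∫ ω, (X t ω - X s ω) * (Y t' ω - Y s' ω) ∂μ : ℝ) : ℂ) := by
  rw [L2.inner_def, ← integral_complex_ofReal]
  refine integral_congr_ae ?_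
  filter_upwards [Lp.coeFn_sub (hX t).toLp (hX s).toLp, Lp.coeFn_sub (hY t').toLp (hY s').toLp,
    (hX t).coeFn_toLp, (hX s).coeFn_toLp, (hY t').coeFn_toLp, (hY s').coeFn_toLp]
    with ω h1 h2 h3 h4 h5 h6
  rw [h1, h2, Pi.sub_apply, Pi.sub_apply, h3, h4, h5, h6, RCLike.inner_apply]
  simp [mul_comm]

/-- Brownian increments have an isometric, hence contractive, spectral representation. -/
theorem IsTwoSidedStdBM.exists_contraction {Ω : Type*} [MeasurableSpace Ω] {μ : Measure Ω}
    {W : ℝ → Ω → ℝ} (hW : IsTwoSidedStdBM μ W) :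
    ∃ J : Lp ℂ 2 (volume : Measure ℝ) →L[ℂ] Lp ℂ 2 μ, ‖J‖ ≤ 1 ∧
      ∀ t, J (spectralInterval t) = (hW.memLp_ofReal t).toLp := by
  refine exists_contraction_of_inner_eq spectralInterval _ dense_span_spectralInterval
    fun t s => ?_
  rw [inner_spectralInterval, ← hW.2.2.2.2 t s, L2.inner_def, ← integral_complex_ofReal]
  refine integral_congr_ae ?_
  filter_upwards [(hW.memLp_ofReal t).coeFn_toLp, (hW.memLp_ofReal s).coeFn_toLp] with ω h1 h2
  rw [h1, h2, RCLike.inner_apply]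
  simp [mul_comm]

/-- The Fourier kernel of a pair of increments. -/
def incrementKernel (s t s' t' l : ℝ) : ℂ :=
  (Complex.exp (-(Complex.I * l * s)) - Complex.exp (-(Complex.I * l * t))) *
    (Complex.exp (Complex.I * l * s') - Complex.exp (Complex.I * l * t')) / ((l : ℂ) ^ 2)

theorem incrementKernel_neg (s t s' t' l : ℝ) :
    incrementKernel s t s' t' (-l) = (starRingEnd ℂ) (incrementKernel s t s' t' l) := by
  simp [incrementKernel, ← Complex.exp_conj]

theorem spectralInterval_mul_conj_ae_eq (s t s' t' : ℝ) :
    ∀ᵐ x, (spectralInterval t - spectralInterval s : Lp ℂ 2 (volume : Measure ℝ)) x *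
      (starRingEnd ℂ) ((spectralInterval t' - spectralInterval s' : Lp ℂ 2 (volume : Measure ℝ)) x) =
        incrementKernel s t s' t' (2 * Real.pi * x) := by
  filter_upwards [Lp.coeFn_sub (spectralInterval t) (spectralInterval s),
    Lp.coeFn_sub (spectralInterval t') (spectralInterval s'), spectralInterval_ae_eq t,
    spectralInterval_ae_eq s, spectralInterval_ae_eq t', spectralInterval_ae_eq s']
    with x h1 h2 h3 h4 h5 h6
  rw [h1, h2, Pi.sub_apply, Pi.sub_apply, h3, h4, h5, h6, incrementKernel, ← sub_div, ← sub_div,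
    map_div₀, div_mul_div_comm]
  simp only [map_sub, map_one, ← Complex.exp_conj, map_neg, map_mul, Complex.conj_I,
    Complex.conj_ofReal, Complex.conj_ofNat]
  have hI : (2 * Real.pi * Complex.I * x : ℂ) * (2 * Real.pi * -Complex.I * x) =
      ((2 * Real.pi * x : ℝ) : ℂ) ^ 2 := by
    push_cast
    linear_combination -(2 * Real.pi * x : ℂ) ^ 2 * Complex.I_sq
  rw [hI]
  congr 1
  have e1 (a : ℝ) : Complex.exp (-(2 * Real.pi * Complex.I * x * a)) =
      Complex.exp (-(Complex.I * (2 * Real.pi * x : ℝ) * a)) := by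
    congr 1; push_cast; ring
  have e2 (a : ℝ) : Complex.exp (-(2 * Real.pi * -Complex.I * x * a)) =
      Complex.exp (Complex.I * (2 * Real.pi * x : ℝ) * a) := by
    congr 1; push_cast; ring
  rw [e1, e1, e2, e2]
  ring

/-- The covariance of increments is the integral of the kernel against a bounded multiplier. -/
theorem exists_bounded_density {Ω : Type*} [MeasurableSpace Ω] (μ : Measure Ω)
    (B : Fin 2 → ℝ → Ω → ℝ) (hstat : HasStationaryIncrements μ B)
    (hBM1 : IsTwoSidedStdBM μ (B 0)) (hBM2 : IsTwoSidedStdBM μ (B 1)) :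
    ∃ f : ℝ → ℂ, Measurable f ∧ (∀ᵐ l : ℝ, ‖f l‖ ≤ 1) ∧ ∀ s t s' t' : ℝ,
      Integrable (fun l => incrementKernel s t s' t' l * f l) ∧
      ((∫ ω, (B 0 t ω - B 0 s ω) * (B 1 t' ω - B 1 s' ω) ∂μ : ℝ) : ℂ) =
        (1 / (2 * (Real.pi : ℂ))) * ∫ l, incrementKernel s t s' t' l * f l := by
  obtain ⟨J, hJ1, hJ⟩ := hBM1.exists_contraction
  obtain ⟨K, hK1, hK⟩ := hBM2.exists_contraction
  set N := J.adjoint ∘L K with hNdef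
  have hN1 : ‖N‖ ≤ 1 := by
    refine (ContinuousLinearMap.opNorm_comp_le _ _).trans (mul_le_one₀ ?_ (norm_nonneg _) hK1)
    rwa [LinearIsometryEquiv.norm_map]
  have hcov (t s t' s' : ℝ) : inner ℂ (N (spectralInterval t - spectralInterval s))
      (spectralInterval t' - spectralInterval s') =
        ((∫ ω, (B 1 t ω - B 1 s ω) * (B 0 t' ω - B 0 s' ω) ∂μ : ℝ) : ℂ) := by
    rw [hNdef, ContinuousLinearMap.comp_apply, ContinuousLinearMap.adjoint_inner_left, map_sub,
      map_sub, hJ, hJ, hK, hK, inner_toLp_ofReal_sub hBM2.memLp_ofReal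
        hBM1.memLp_ofReal]
  obtain ⟨m, hm, hm1, hmul⟩ := exists_multiplier N hN1 fun t s t' s' h => by
    rw [hcov, hcov, hstat]
  have hpi : (2 * Real.pi) ≠ 0 := by positivity
  have hae (s t s' t' : ℝ) : ∀ᵐ x,
      (N.adjoint (spectralInterval t - spectralInterval s)) x * (starRingEnd ℂ)
        ((spectralInterval t' - spectralInterval s' : Lp ℂ 2 (volume : Measure ℝ)) x) =
      incrementKernel s t s' t' (2 * Real.pi * x) * m (2 * Real.pi * x / (2 * Real.pi)) := by
    filter_upwards [hmul (spectralInterval t - spectralInterval s),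
      spectralInterval_mul_conj_ae_eq s t s' t'] with x h1 h2
    rw [h1, mul_div_cancel_left₀ _ hpi, ← h2]
    ring
  refine ⟨fun l => m (l / (2 * Real.pi)), hm.comp (measurable_id.div_const _), ?_,
    fun s t s' t' => ⟨?_, ?_⟩⟩
  · have hq : Measure.QuasiMeasurePreserving (fun l : ℝ => l / (2 * Real.pi)) volume volume := by
      refine ⟨measurable_id.div_const _, ?_⟩
      simp only [div_eq_mul_inv]
      rw [Real.map_volume_mul_right (inv_ne_zero hpi)]
      exact Measure.smul_absolutelyContinuous
    exact hq.ae hm1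
  · rw [← integrable_comp_mul_left_iff _ hpi]
    exact (integrable_mul_conj _ _).congr (hae s t s' t')
  · have h1 := hcov t' s' t s
    rw [← ContinuousLinearMap.adjoint_inner_right, L2.inner_def] at h1
    simp only [RCLike.inner_apply] at h1
    rw [integral_congr_ae (hae s t s' t'), Measure.integral_comp_mul_left
      (fun l => incrementKernel s t s' t' l * m (l / (2 * Real.pi)))] at h1
    simp only [mul_comm (B 0 t _ - B 0 s _)]
    rw [← h1, abs_of_pos (by positivity), Complex.real_smul]
    push_cast
    rw [one_div]

theorem statement1 {Ω : Type*} [MeasurableSpace Ω] (μ : Measure Ω) [IsProbabilityMeasure μ]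
    (B : Fin 2 → ℝ → Ω → ℝ)
    (hstat : HasStationaryIncrements μ B)
    (hBM1 : IsTwoSidedStdBM μ (B 0)) (hBM2 : IsTwoSidedStdBM μ (B 1)) :
    ∃ f : ℝ → ℂ, Measurable f ∧
      (∀ᵐ l : ℝ, ‖f l‖ ≤ 1) ∧
      (∀ᵐ l : ℝ, (starRingEnd ℂ) (f l) = f (-l)) ∧
      IsCrossSpectralDensity μ (B 0) (B 1) f := by
  obtain ⟨g, hg, hg1, hgint⟩ := exists_bounded_density μ B hstat hBM1 hBM2
  refine ⟨fun l => (g l + (starRingEnd ℂ) (g (-l))) / 2, ?_, ?_, .of_forall fun l => ?_,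
    fun s t s' t' _ _ => ?_⟩
  · exact (hg.add (Complex.continuous_conj.measurable.comp
      (hg.comp measurable_neg))).div_const 2
  · filter_upwards [hg1, (Measure.measurePreserving_neg (volume : Measure ℝ)
      ).quasiMeasurePreserving.ae hg1] with l h1 h2
    rw [norm_div, Complex.norm_ofNat, div_le_one two_pos]
    refine (norm_add_le _ _).trans ?_
    rw [RCLike.norm_conj]
    linarith
  · simp [Complex.conj_ofNat, add_comm]
  · obtain ⟨hi, he⟩ := hgint s t s' t'
    have hconj : ∀ l : ℝ, incrementKernel s t s' t' l * (starRingEnd ℂ) (g (-l)) =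
        (starRingEnd ℂ) (incrementKernel s t s' t' (-l) * g (-l)) := fun l => by
      rw [incrementKernel_neg, map_mul, Complex.conj_conj]
    have hi' : Integrable (fun l => incrementKernel s t s' t' l * (starRingEnd ℂ) (g (-l))) := by
      simp only [hconj]
      exact (Complex.conjLIE.integrable_comp_iff).2 hi.comp_neg
    have he' : ∫ l, incrementKernel s t s' t' l * (starRingEnd ℂ) (g (-l)) =
        (starRingEnd ℂ) (∫ l, incrementKernel s t s' t' l * g l) := by
      simp only [hconj]
      rw [integral_conj, integral_neg_eq_self (fun l => incrementKernel s t s' t' l * g l)]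
    have hc := congrArg (starRingEnd ℂ) he
    simp only [Complex.conj_ofReal, map_mul, map_div₀, map_one, Complex.conj_ofNat] at hc
    calc _ = (1 / (2 * (Real.pi : ℂ))) * ∫ l, (incrementKernel s t s' t' l * g l +
          incrementKernel s t s' t' l * (starRingEnd ℂ) (g (-l))) / 2 := by
          rw [integral_div, integral_add hi hi', he']
          linear_combination he / 2 + hc / 2
      _ = _ := by
          congr 2
          ext l
          rw [incrementKernel]
          ring

end
end

section
/- Suppose the even positive integers L = L^{(J)} satisfy L^{(J)} → ∞ and (L^{(J)})²·τ_J → 0 as J → ∞, and let (ϑ_J)_{J∈ℕ} be reals with ϑ_J an integer multiple of τ_J for each J. If (L^{(J)})^{−1/2}·τ_J^{−1}·(ϑ_J − θ_j) → ∞ as J → ∞, then \bar ρ_j(ϑ_J) → 0 as J → ∞. -/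
noncomputable section

def Dfn (l : ℝ) : ℝ := (2 / Real.pi) * (Real.sin (l / 2)) ^ 2 / l ^ 2

def Pifn (p1 p2 : ℝ) (l : ℝ) : ℂ :=
  (((1 - p1) * (1 - p2) : ℝ) : ℂ) /
    ((1 - (p1 : ℂ) * Complex.exp (Complex.I * l)) *
      (1 - (p2 : ℂ) * Complex.exp (-(Complex.I * l))))

def HLfn (L : ℕ) (l : ℝ) : ℝ :=
  2 * (Real.sin (l / 2)) ^ L *
    ∑ p ∈ Finset.range (L / 2), ((L / 2 - 1 + p).choose p : ℝ) * (Real.cos (l / 2)) ^ (2 * p)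

def GLfn (L : ℕ) (l : ℝ) : ℝ := HLfn L (l - Real.pi)

def HjL (j L : ℕ) (l : ℝ) : ℝ :=
  HLfn L (2 ^ (j - 1) * l) * ∏ i ∈ Finset.range (j - 1), GLfn L (2 ^ i * l)

def cL (L : ℕ) : ℝ := ((L - 2).choose (L / 2 - 1) : ℝ) * ((L : ℝ) - 1) / 2 ^ (L - 2)

def Lam (j : ℤ) : Set ℝ :=
  Set.Ico (-((2 : ℝ) ^ (j + 1) * Real.pi)) (-((2 : ℝ) ^ j * Real.pi)) ∪
    Set.Ioc ((2 : ℝ) ^ j * Real.pi) ((2 : ℝ) ^ (j + 1) * Real.pi)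

def tauJ (J : ℕ) : ℝ := ((2 : ℝ) ^ (J + 1))⁻¹

def fJ (R θv : ℕ → ℝ) (J : ℕ) (l : ℝ) : ℂ :=
  ∑ i ∈ Finset.Icc 1 (J + 1),
    ((R i : ℝ) : ℂ) * Complex.exp (-(Complex.I * (θv i : ℝ) * l)) *
      (Lam ((J : ℤ) - i + 1)).indicator (fun _ => (1 : ℂ)) l

def rhoBar (R θv : ℕ → ℝ) (p1 p2 : ℝ) (j L J : ℕ) (th : ℝ) : ℂ :=
  ∫ l : ℝ, ((Dfn l : ℝ) : ℂ) * ((HjL j L l : ℝ) : ℂ) * Pifn p1 p2 l *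
    Complex.exp (Complex.I * ((tauJ J)⁻¹ * th) * l) * fJ R θv J ((tauJ J)⁻¹ * l)

def psiLP (s : ℝ) : ℝ :=
  if s = 0 then 1
  else 2 * (Real.sin (2 * Real.pi * s) / (2 * Real.pi * s)) - Real.sin (Real.pi * s) / (Real.pi * s)

def psiLPj (j : ℤ) (t : ℝ) : ℝ := (2 : ℝ) ^ ((j : ℝ) / 2) * psiLP ((2 : ℝ) ^ j * t)


open Filter Topology MeasureTheory

/-- The Daubechies polynomial `y ^ N * ∑ p < N, C(N - 1 + p, p) (1 - y) ^ p`. -/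
def daubPoly (N : ℕ) (y : ℝ) : ℝ :=
  y ^ N * ∑ p ∈ Finset.range N, ((N - 1 + p).choose p : ℝ) * (1 - y) ^ p

lemma hasSum_choose_add_mul_pow {N : ℕ} (hN : 0 < N) {y : ℝ} (h0 : 0 < y) (h1 : y ≤ 1) :
    HasSum (fun p : ℕ => ((N - 1 + p).choose p : ℝ) * (1 - y) ^ p) (1 / y ^ N) := by
  obtain ⟨k, rfl⟩ : ∃ k, N = k + 1 := ⟨N - 1, by omega⟩
  have hn : ‖1 - y‖ < 1 := by
    rw [Real.norm_eq_abs, abs_lt]; constructor <;> linarith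
  have h := hasSum_choose_mul_geometric_of_norm_lt_one (𝕜 := ℝ) k hn
  rw [sub_sub_cancel] at h
  convert! h using 3 with p
  rw [Nat.add_sub_cancel, Nat.add_comm k p, Nat.choose_symm_add]

lemma daubPoly_nonneg (N : ℕ) {y : ℝ} (h0 : 0 ≤ y) (h1 : y ≤ 1) : 0 ≤ daubPoly N y := by
  have : 0 ≤ 1 - y := by linarith
  unfold daubPoly; positivity

lemma daubPoly_le_one {N : ℕ} (hN : 0 < N) {y : ℝ} (h0 : 0 ≤ y) (h1 : y ≤ 1) :
    daubPoly N y ≤ 1 := by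
  rcases h0.eq_or_lt with rfl | h0
  · simp [daubPoly, hN.ne']
  have hs := sum_le_hasSum (Finset.range N)
    (fun p _ => mul_nonneg (Nat.cast_nonneg _) (pow_nonneg (by linarith) p))
    (hasSum_choose_add_mul_pow hN h0 h1)
  calc daubPoly N y ≤ y ^ N * (1 / y ^ N) := by
        unfold daubPoly; gcongr
    _ = 1 := by field_simp

lemma daubPoly_le_pow {N : ℕ} (hN : 0 < N) {y : ℝ} (h0 : 0 ≤ y) (h1 : y ≤ 1 / 2) :
    daubPoly N y ≤ (4 * y * (1 - y)) ^ N := by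
  have hs := sum_le_hasSum (Finset.range N)
    (fun p _ => mul_nonneg (Nat.cast_nonneg _) (pow_nonneg (by norm_num) p))
    (hasSum_choose_add_mul_pow hN (y := 1 / 2) (by norm_num) (by norm_num))
  have hterm : ∑ p ∈ Finset.range N, ((N - 1 + p).choose p : ℝ) * (1 - y) ^ p ≤
      (2 * (1 - y)) ^ N *
        ∑ p ∈ Finset.range N, ((N - 1 + p).choose p : ℝ) * (1 - 1 / 2 : ℝ) ^ p := by
    rw [Finset.mul_sum]
    refine Finset.sum_le_sum fun p hp => ?_
    have e : (1 - y) ^ p = (2 * (1 - y)) ^ p * (1 - 1 / 2 : ℝ) ^ p := by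
      rw [← mul_pow]; ring_nf
    have : (2 * (1 - y)) ^ p ≤ (2 * (1 - y)) ^ N :=
      pow_le_pow_right₀ (by linarith) (Finset.mem_range.1 hp).le
    rw [e, mul_left_comm]
    gcongr
  have hy : 0 ≤ 2 * (1 - y) := by linarith
  calc daubPoly N y ≤ y ^ N * ((2 * (1 - y)) ^ N * (1 / (1 / 2) ^ N)) := by
        unfold daubPoly
        gcongr
        exact hterm.trans (by gcongr)
    _ = (4 * y * (1 - y)) ^ N := by
        rw [one_div, ← inv_pow, ← mul_pow, ← mul_pow]; ring_nf

lemma one_sub_daubPoly_le_pow {N : ℕ} (hN : 0 < N) {y : ℝ} (h0 : 1 / 2 ≤ y) (h1 : y ≤ 1) :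
    1 - daubPoly N y ≤ (4 * y * (1 - y)) ^ N := by
  have hy : 0 < y := by linarith
  have hy' : 0 ≤ 1 - y := by linarith
  set c : ℕ → ℝ := fun p => ((N - 1 + p).choose p : ℝ)
  have hc0 : ∀ p, 0 ≤ c p := fun p => Nat.cast_nonneg _
  have hs := hasSum_choose_add_mul_pow hN hy h1
  have hh := hasSum_choose_add_mul_pow hN (y := 1 / 2) (by norm_num) (by norm_num)
  have ht := (hasSum_nat_add_iff' N).2 hs
  have hth := (hasSum_nat_add_iff' N).2 hh
  have hle : 1 / y ^ N - ∑ p ∈ Finset.range N, c p * (1 - y) ^ p ≤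
      (2 * (1 - y)) ^ N * (1 / (1 / 2) ^ N) := by
    have h2 : (2 * (1 - y)) ^ N * (1 / (1 / 2) ^ N -
        ∑ p ∈ Finset.range N, c p * (1 - 1 / 2 : ℝ) ^ p) ≤
        (2 * (1 - y)) ^ N * (1 / (1 / 2) ^ N) := by
      gcongr
      have : 0 ≤ ∑ p ∈ Finset.range N, c p * (1 - 1 / 2 : ℝ) ^ p :=
        Finset.sum_nonneg fun p _ => mul_nonneg (hc0 p) (by positivity)
      linarith
    refine (hasSum_le (fun p => ?_) ht (hth.mul_left ((2 * (1 - y)) ^ N))).trans h2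
    have e : (1 - y) ^ (p + N) = (2 * (1 - y)) ^ (p + N) * (1 - 1 / 2 : ℝ) ^ (p + N) := by
      rw [← mul_pow]; ring_nf
    have : (2 * (1 - y)) ^ (p + N) ≤ (2 * (1 - y)) ^ N :=
      pow_le_pow_of_le_one (by linarith) (by linarith) (by omega)
    rw [e, mul_left_comm]
    gcongr
  calc 1 - daubPoly N y = y ^ N * (1 / y ^ N - ∑ p ∈ Finset.range N, c p * (1 - y) ^ p) := by
        unfold daubPoly; rw [mul_sub]; field_simp; rfl
    _ ≤ y ^ N * ((2 * (1 - y)) ^ N * (1 / (1 / 2) ^ N)) := by gcongr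
    _ = (4 * y * (1 - y)) ^ N := by
        rw [one_div, ← inv_pow, ← mul_pow, ← mul_pow]; ring_nf

lemma tendsto_daubPoly_of_lt {y : ℝ} (h0 : 0 ≤ y) (h1 : y < 1 / 2) :
    Tendsto (fun N => daubPoly N y) atTop (𝓝 0) := by
  refine squeeze_zero' (.of_forall fun N => daubPoly_nonneg N h0 (by linarith))
    ((eventually_gt_atTop 0).mono fun N hN => daubPoly_le_pow hN h0 h1.le)
    (tendsto_pow_atTop_nhds_zero_of_lt_one ?_ ?_)
  · have : 0 ≤ 1 - y := by linarith
    positivity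
  · nlinarith [sq_pos_of_neg (sub_neg.2 h1)]

lemma tendsto_daubPoly_of_gt {y : ℝ} (h0 : 1 / 2 < y) (h1 : y ≤ 1) :
    Tendsto (fun N => daubPoly N y) atTop (𝓝 1) := by
  have : Tendsto (fun N => 1 - daubPoly N y) atTop (𝓝 0) := by
    refine squeeze_zero'
      ((eventually_gt_atTop 0).mono fun N hN => ?_)
      ((eventually_gt_atTop 0).mono fun N hN => one_sub_daubPoly_le_pow hN h0.le h1)
      (tendsto_pow_atTop_nhds_zero_of_lt_one ?_ ?_)
    · linarith [daubPoly_le_one hN (by linarith : 0 ≤ y) h1]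
    · have : 0 ≤ 1 - y := by linarith
      positivity
    · nlinarith [sq_pos_of_pos (sub_pos.2 h0)]
  simpa using this.const_sub 1

lemma HLfn_eq_daubPoly {L : ℕ} (hL : Even L) (l : ℝ) :
    HLfn L l = 2 * daubPoly (L / 2) ((1 - Real.cos l) / 2) := by
  obtain ⟨N, rfl⟩ := hL
  have hs : Real.sin (l / 2) ^ 2 = (1 - Real.cos l) / 2 := by
    rw [Real.sin_sq_eq_half_sub]; ring_nf
  have hc : Real.cos (l / 2) ^ 2 = 1 - (1 - Real.cos l) / 2 := by
    rw [Real.cos_sq']; rw [hs]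
  simp only [HLfn, daubPoly, pow_mul, hc, ← two_mul, hs]
  simp [mul_assoc]

lemma HLfn_nonneg {L : ℕ} (hL : Even L) (l : ℝ) : 0 ≤ HLfn L l := by
  rw [HLfn_eq_daubPoly hL]
  have := daubPoly_nonneg (L / 2) (y := (1 - Real.cos l) / 2)
    (by linarith [Real.cos_le_one l]) (by linarith [Real.neg_one_le_cos l])
  positivity

lemma HLfn_le_two {L : ℕ} (hL : Even L) (h0 : 0 < L) (l : ℝ) : HLfn L l ≤ 2 := by
  rw [HLfn_eq_daubPoly hL]
  have := daubPoly_le_one (N := L / 2) (by obtain ⟨N, rfl⟩ := hL; omega)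
    (y := (1 - Real.cos l) / 2)
    (by linarith [Real.cos_le_one l]) (by linarith [Real.neg_one_le_cos l])
  linarith

lemma tendsto_HLfn_of_cos_neg {L : ℕ → ℕ} (hLeven : ∀ J, Even (L J)) (hLinf : Tendsto L atTop atTop)
    {l : ℝ} (hl : Real.cos l < 0) :
    Tendsto (fun J => HLfn (L J) l) atTop (𝓝 2) := by
  simp only [HLfn_eq_daubPoly (hLeven _)]
  have h := (tendsto_daubPoly_of_gt (y := (1 - Real.cos l) / 2) (by linarith)
    (by linarith [Real.neg_one_le_cos l])).comp
      ((Nat.tendsto_div_const_atTop two_ne_zero).comp hLinf)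
  simpa using h.const_mul 2

lemma tendsto_HLfn_of_cos_pos {L : ℕ → ℕ} (hLeven : ∀ J, Even (L J)) (hLinf : Tendsto L atTop atTop)
    {l : ℝ} (hl : 0 < Real.cos l) :
    Tendsto (fun J => HLfn (L J) l) atTop (𝓝 0) := by
  simp only [HLfn_eq_daubPoly (hLeven _)]
  have h := (tendsto_daubPoly_of_lt (y := (1 - Real.cos l) / 2)
    (by linarith [Real.cos_le_one l]) (by linarith)).comp
      ((Nat.tendsto_div_const_atTop two_ne_zero).comp hLinf)
  simpa using h.const_mul 2


lemma cos_sub_pi_neg_iff {x : ℝ} : Real.cos (x - Real.pi) < 0 ↔ 0 < Real.cos x := by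
  rw [Real.cos_sub_pi, neg_lt_zero]

lemma HjL_nonneg (j : ℕ) {L : ℕ} (hL : Even L) (l : ℝ) : 0 ≤ HjL j L l :=
  mul_nonneg (HLfn_nonneg hL _) (Finset.prod_nonneg fun _ _ => HLfn_nonneg hL _)

lemma prod_GLfn_le {L : ℕ} (hL : Even L) (h0 : 0 < L) (s : Finset ℕ) (l : ℝ) :
    ∏ i ∈ s, GLfn L (2 ^ i * l) ≤ 2 ^ s.card := by
  rw [← Finset.prod_const]
  exact Finset.prod_le_prod (fun _ _ => HLfn_nonneg hL _) fun _ _ => HLfn_le_two hL h0 _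

lemma HjL_le {j L : ℕ} (hj : 1 ≤ j) (hL : Even L) (h0 : 0 < L) (l : ℝ) : HjL j L l ≤ 2 ^ j := by
  have h : ∏ i ∈ Finset.range (j - 1), GLfn L (2 ^ i * l) ≤ 2 ^ (j - 1) := by
    simpa using prod_GLfn_le hL h0 (Finset.range (j - 1)) l
  obtain ⟨k, rfl⟩ : ∃ k, j = k + 1 := ⟨j - 1, by omega⟩
  rw [pow_succ']
  exact mul_le_mul (HLfn_le_two hL h0 _) h (Finset.prod_nonneg fun _ _ => HLfn_nonneg hL _)
    zero_le_two

section Dyadic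

lemma ae_exists_mem_dyadic :
    ∀ᵐ l : ℝ, ∃ m : ℤ, (2 : ℝ) ^ m * Real.pi < |l| ∧ |l| < (2 : ℝ) ^ (m + 1) * Real.pi := by
  have h0 : ∀ᵐ l : ℝ, l ≠ 0 := Measure.ae_ne volume 0
  have h1 : ∀ᵐ l : ℝ, ∀ k : ℤ, l ≠ (2 : ℝ) ^ k * Real.pi :=
    ae_all_iff.2 fun k => Measure.ae_ne volume _
  have h2 : ∀ᵐ l : ℝ, ∀ k : ℤ, l ≠ -((2 : ℝ) ^ k * Real.pi) :=
    ae_all_iff.2 fun k => Measure.ae_ne volume _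
  filter_upwards [h0, h1, h2] with l h0 h1 h2
  obtain ⟨m, hm1, hm2⟩ := exists_mem_Ico_zpow (div_pos (abs_pos.2 h0) Real.pi_pos)
    (one_lt_two (α := ℝ))
  rw [le_div_iff₀ Real.pi_pos] at hm1
  rw [div_lt_iff₀ Real.pi_pos] at hm2
  refine ⟨m, hm1.lt_of_ne fun h => ?_, hm2⟩
  rcases (abs_eq (by positivity)).1 h.symm with h | h
  · exact h1 m h
  · exact h2 m h

variable {m : ℤ} {l : ℝ}

lemma mem_Lam_iff (h1 : (2 : ℝ) ^ m * Real.pi < |l|) (h2 : |l| < (2 : ℝ) ^ (m + 1) * Real.pi)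
    (k : ℤ) : l ∈ Lam k ↔ k = m := by
  have hpi := Real.pi_pos
  constructor
  · intro h
    have hk : (2 : ℝ) ^ k * Real.pi ≤ |l| ∧ |l| ≤ (2 : ℝ) ^ (k + 1) * Real.pi := by
      have : 0 < (2 : ℝ) ^ k * Real.pi := by positivity
      rcases h with ⟨ha, hb⟩ | ⟨ha, hb⟩
      · rw [abs_of_neg (by linarith)]; constructor <;> linarith
      · rw [abs_of_pos (by linarith)]; constructor <;> linarith
    have e1 := lt_of_mul_lt_mul_right (hk.1.trans_lt h2) hpi.le
    have e2 := lt_of_mul_lt_mul_right (h1.trans_le hk.2) hpi.le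
    rw [zpow_lt_zpow_iff_right₀ one_lt_two] at e1 e2
    omega
  · rintro rfl
    rcases le_total 0 l with h | h
    · rw [abs_of_nonneg h] at h1 h2
      exact Or.inr ⟨h1, h2.le⟩
    · rw [abs_of_nonpos h] at h1 h2
      exact Or.inl ⟨by linarith, by linarith⟩

lemma inv_tauJ_mul_mem_Lam_iff (h1 : (2 : ℝ) ^ m * Real.pi < |l|)
    (h2 : |l| < (2 : ℝ) ^ (m + 1) * Real.pi) (J i : ℕ) :
    (tauJ J)⁻¹ * l ∈ Lam ((J : ℤ) - i + 1) ↔ m = -(i : ℤ) := by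
  have habs : |(tauJ J)⁻¹ * l| = (2 : ℝ) ^ ((J : ℤ) + 1) * |l| := by
    rw [tauJ, inv_inv, abs_mul, abs_of_pos (by positivity)]
    norm_cast
  rw [mem_Lam_iff (m := (J + 1) + m)]
  · omega
  · rw [habs, zpow_add₀ two_ne_zero, mul_assoc]; gcongr
  · rw [habs, add_assoc, zpow_add₀ two_ne_zero _ (m + 1), mul_assoc]; gcongr

lemma fJ_inv_tauJ_mul_of_nonneg (R θv : ℕ → ℝ) (h1 : (2 : ℝ) ^ m * Real.pi < |l|)
    (h2 : |l| < (2 : ℝ) ^ (m + 1) * Real.pi) (hm : 0 ≤ m) (J : ℕ) :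
    fJ R θv J ((tauJ J)⁻¹ * l) = 0 := by
  refine Finset.sum_eq_zero fun i hi => ?_
  rw [Finset.mem_Icc] at hi
  rw [Set.indicator_of_notMem, mul_zero]
  rw [inv_tauJ_mul_mem_Lam_iff h1 h2]
  omega

lemma fJ_inv_tauJ_mul_of_neg (R θv : ℕ → ℝ) {n : ℕ} (hn : 1 ≤ n)
    (h1 : (2 : ℝ) ^ (-n : ℤ) * Real.pi < |l|)
    (h2 : |l| < (2 : ℝ) ^ (-n + 1 : ℤ) * Real.pi) (J : ℕ) :
    fJ R θv J ((tauJ J)⁻¹ * l) = if n ≤ J + 1 then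
      (R n : ℂ) * Complex.exp (-(Complex.I * (θv n : ℝ) * ((tauJ J)⁻¹ * l : ℝ))) else 0 := by
  have hind : ∀ i : ℕ, (Lam ((J : ℤ) - i + 1)).indicator (fun _ => (1 : ℂ)) ((tauJ J)⁻¹ * l) =
      if n = i then 1 else 0 := by
    intro i
    have hiff := inv_tauJ_mul_mem_Lam_iff h1 h2 J i
    rw [neg_inj, Nat.cast_inj] at hiff
    split_ifs with h
    · exact Set.indicator_of_mem (hiff.2 h) _
    · exact Set.indicator_of_notMem (mt hiff.1 h) _
  unfold fJ
  simp only [hind, mul_ite, mul_one, mul_zero, Finset.sum_ite_eq, Finset.mem_Icc, hn, true_and]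

lemma cos_two_pow_mul_neg {n : ℕ} (h1 : (2 : ℝ) ^ (-(n + 1 : ℕ) : ℤ) * Real.pi < |l|)
    (h2 : |l| < (2 : ℝ) ^ (-(n + 1 : ℕ) + 1 : ℤ) * Real.pi) : Real.cos (2 ^ n * l) < 0 := by
  have hp : (0 : ℝ) < 2 ^ n := by positivity
  have e1 : (2 : ℝ) ^ (-(n + 1 : ℕ) : ℤ) = (2 ^ n)⁻¹ * (1 / 2) := by
    rw [zpow_neg, zpow_natCast, pow_succ, mul_inv, one_div]
  have e2 : (2 : ℝ) ^ (-(n + 1 : ℕ) + 1 : ℤ) = (2 ^ n)⁻¹ := by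
    rw [Nat.cast_succ, neg_add, neg_add_cancel_right, zpow_neg, zpow_natCast]
  rw [e1, mul_assoc, inv_mul_lt_iff₀ hp] at h1
  rw [e2, lt_inv_mul_iff₀ hp] at h2
  rw [← Real.cos_abs, abs_mul, abs_of_pos hp]
  exact Real.cos_neg_of_pi_div_two_lt_of_lt (by linarith) (by linarith [Real.pi_pos])

lemma cos_two_pow_mul_pos {n i : ℕ} (hi : i < n)
    (h2 : |l| < (2 : ℝ) ^ (-(n + 1 : ℕ) + 1 : ℤ) * Real.pi) : 0 < Real.cos (2 ^ i * l) := by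
  have hp : (0 : ℝ) < 2 ^ n := by positivity
  have e2 : (2 : ℝ) ^ (-(n + 1 : ℕ) + 1 : ℤ) = (2 ^ n)⁻¹ := by
    rw [Nat.cast_succ, neg_add, neg_add_cancel_right, zpow_neg, zpow_natCast]
  rw [e2, lt_inv_mul_iff₀ hp] at h2
  have h3 : (2 : ℝ) ^ (i + 1) * |l| ≤ 2 ^ n * |l| := by
    gcongr
    · norm_num
    · omega
  have h4 : 2 * (2 ^ i * |l|) < Real.pi := by
    rw [pow_succ'] at h3; linarith
  rw [← Real.cos_abs, abs_mul, abs_of_pos (by positivity)]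
  refine Real.cos_pos_of_mem_Ioo ⟨?_, by linarith⟩
  have : 0 ≤ 2 ^ i * |l| := by positivity
  linarith [Real.pi_pos]

lemma tendsto_HjL_of_eq {L : ℕ → ℕ} (hLeven : ∀ J, Even (L J)) (hLinf : Tendsto L atTop atTop)
    {n : ℕ} (h1 : (2 : ℝ) ^ (-(n + 1 : ℕ) : ℤ) * Real.pi < |l|)
    (h2 : |l| < (2 : ℝ) ^ (-(n + 1 : ℕ) + 1 : ℤ) * Real.pi) :
    Tendsto (fun J => HjL (n + 1) (L J) l) atTop (𝓝 (2 ^ (n + 1))) := by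
  have hG : Tendsto (fun J => ∏ i ∈ Finset.range n, GLfn (L J) (2 ^ i * l)) atTop
      (𝓝 (∏ _i ∈ Finset.range n, 2)) :=
    tendsto_finsetProd _ fun i hi => tendsto_HLfn_of_cos_neg hLeven hLinf
      (cos_sub_pi_neg_iff.2 (cos_two_pow_mul_pos (Finset.mem_range.1 hi) h2))
  have hH := tendsto_HLfn_of_cos_neg hLeven hLinf (cos_two_pow_mul_neg h1 h2)
  simpa [HjL, pow_succ'] using hH.mul hG

lemma tendsto_HjL_of_ne {L : ℕ → ℕ} (hLeven : ∀ J, Even (L J)) (hLpos : ∀ J, 0 < L J)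
    (hLinf : Tendsto L atTop atTop) {n k : ℕ} (hnk : n ≠ k)
    (h1 : (2 : ℝ) ^ (-(n + 1 : ℕ) : ℤ) * Real.pi < |l|)
    (h2 : |l| < (2 : ℝ) ^ (-(n + 1 : ℕ) + 1 : ℤ) * Real.pi) :
    Tendsto (fun J => HjL (k + 1) (L J) l) atTop (𝓝 0) := by
  rcases hnk.lt_or_gt with h | h
  · have hG : Tendsto (fun J => GLfn (L J) (2 ^ n * l)) atTop (𝓝 0) := by
      refine tendsto_HLfn_of_cos_pos hLeven hLinf ?_
      rw [Real.cos_sub_pi, neg_pos]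
      exact cos_two_pow_mul_neg h1 h2
    have hlim := hG.const_mul (2 * 2 ^ k)
    rw [mul_zero] at hlim
    refine squeeze_zero (fun J => HjL_nonneg _ (hLeven J) _) (fun J => ?_) hlim
    have hE : ∏ i ∈ (Finset.range k).erase n, GLfn (L J) (2 ^ i * l) ≤ 2 ^ k := by
      refine (prod_GLfn_le (hLeven J) (hLpos J) _ l).trans
        (pow_le_pow_right₀ one_le_two ?_)
      simpa using Finset.card_le_card (Finset.erase_subset n (Finset.range k))
    have hE0 : 0 ≤ ∏ i ∈ (Finset.range k).erase n, GLfn (L J) (2 ^ i * l) :=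
      Finset.prod_nonneg fun _ _ => HLfn_nonneg (hLeven J) _
    have hG0 : 0 ≤ GLfn (L J) (2 ^ n * l) := HLfn_nonneg (hLeven J) _
    have hH := HLfn_le_two (hLeven J) (hLpos J) (2 ^ k * l)
    rw [HjL, Nat.add_sub_cancel, ← Finset.mul_prod_erase _ _ (Finset.mem_range.2 h)]
    calc _ ≤ 2 * (GLfn (L J) (2 ^ n * l) * 2 ^ k) :=
          mul_le_mul hH (mul_le_mul_of_nonneg_left hE hG0) (mul_nonneg hG0 hE0) zero_le_two
      _ = _ := by ring
  · have hH := tendsto_HLfn_of_cos_pos hLeven hLinf (cos_two_pow_mul_pos h h2)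
    have hlim := hH.const_mul (2 ^ k)
    rw [mul_zero] at hlim
    refine squeeze_zero (fun J => HjL_nonneg _ (hLeven J) _) (fun J => ?_) hlim
    rw [HjL, Nat.add_sub_cancel, mul_comm]
    have hE : ∏ i ∈ Finset.range k, GLfn (L J) (2 ^ i * l) ≤ 2 ^ k := by
      simpa using prod_GLfn_le (hLeven J) (hLpos J) (Finset.range k) l
    have := HLfn_nonneg (hLeven J) (2 ^ k * l)
    gcongr

end Dyadic

lemma Dfn_nonneg (l : ℝ) : 0 ≤ Dfn l := by
  have := Real.pi_pos
  unfold Dfn; positivity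

lemma Dfn_le_one (l : ℝ) : Dfn l ≤ 1 := by
  have hpi := Real.pi_gt_three
  rcases eq_or_ne l 0 with rfl | hl
  · simp [Dfn]
  have hl2 : 0 < l ^ 2 := by positivity
  have h1 : Real.sin (l / 2) ^ 2 ≤ (l / 2) ^ 2 := sq_le_sq.2 Real.abs_sin_le_abs
  have h2 : 2 / Real.pi ≤ 1 := by rw [div_le_one (by linarith)]; linarith
  rw [Dfn, div_le_one hl2]
  calc 2 / Real.pi * Real.sin (l / 2) ^ 2 ≤ 1 * (l / 2) ^ 2 := by gcongr
    _ ≤ l ^ 2 := by nlinarith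

lemma one_sub_le_norm_one_sub_mul {p : ℝ} (hp : 0 ≤ p) {z : ℂ} (hz : ‖z‖ = 1) :
    1 - p ≤ ‖1 - (p : ℂ) * z‖ := by
  have := norm_sub_norm_le (1 : ℂ) (p * z)
  rwa [norm_mul, hz, norm_one, Complex.norm_of_nonneg hp, mul_one] at this

lemma norm_Pifn_le_one {p1 p2 : ℝ} (hp1 : p1 ∈ Set.Ico (0 : ℝ) 1) (hp2 : p2 ∈ Set.Ico (0 : ℝ) 1)
    (l : ℝ) : ‖Pifn p1 p2 l‖ ≤ 1 := by
  have h1 : 0 < 1 - p1 := sub_pos.2 hp1.2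
  have h2 : 0 < 1 - p2 := sub_pos.2 hp2.2
  have e1 := one_sub_le_norm_one_sub_mul hp1.1 (z := Complex.exp (Complex.I * l))
    (by rw [mul_comm, Complex.norm_exp_ofReal_mul_I])
  have e2 := one_sub_le_norm_one_sub_mul hp2.1 (z := Complex.exp (-(Complex.I * l)))
    (by rw [mul_comm, ← neg_mul, ← Complex.ofReal_neg, Complex.norm_exp_ofReal_mul_I])
  rw [Pifn, norm_div, norm_mul, Complex.norm_of_nonneg (by positivity)]
  exact div_le_one_of_le₀ (mul_le_mul e1 e2 h2.le (norm_nonneg _)) (by positivity)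

lemma norm_Dfn_mul_Pifn_le_one {p1 p2 : ℝ} (hp1 : p1 ∈ Set.Ico (0 : ℝ) 1)
    (hp2 : p2 ∈ Set.Ico (0 : ℝ) 1) (l : ℝ) : ‖(Dfn l : ℂ) * Pifn p1 p2 l‖ ≤ 1 := by
  rw [norm_mul, Complex.norm_of_nonneg (Dfn_nonneg l)]
  exact mul_le_one₀ (Dfn_le_one l) (norm_nonneg _) (norm_Pifn_le_one hp1 hp2 l)

@[fun_prop]
lemma measurable_Dfn : Measurable Dfn := by unfold Dfn; fun_prop

@[fun_prop]
lemma measurable_Pifn (p1 p2 : ℝ) : Measurable (Pifn p1 p2) := by unfold Pifn; fun_prop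

@[fun_prop]
lemma measurable_HLfn (L : ℕ) : Measurable (HLfn L) := by unfold HLfn; fun_prop

@[fun_prop]
lemma measurable_HjL (j L : ℕ) : Measurable (HjL j L) := by unfold HjL GLfn; fun_prop

lemma measurableSet_Lam (k : ℤ) : MeasurableSet (Lam k) := measurableSet_Ico.union measurableSet_Ioc

@[fun_prop]
lemma measurable_fJ (R θv : ℕ → ℝ) (J : ℕ) : Measurable (fJ R θv J) := by
  unfold fJ
  refine Finset.measurable_fun_sum _ fun i _ => Measurable.mul (by fun_prop) ?_
  exact measurable_const.indicator (measurableSet_Lam _)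

/-- Riemann-Lebesgue lemma with the kernel `exp (i n l)` along a sequence of frequencies. -/
lemma tendsto_integral_exp_I_mul {ι : Type*} {F : Filter ι} {n : ι → ℝ} (hn : Tendsto n F atTop)
    (K : ℝ → ℂ) :
    Tendsto (fun J => ∫ l : ℝ, Complex.exp (Complex.I * (n J : ℝ) * l) * K l) F (𝓝 0) := by
  have hw : Tendsto (fun J => -(n J) / (2 * Real.pi)) F (cocompact ℝ) :=
    ((tendsto_neg_atTop_atBot.comp hn).atBot_div_const Real.two_pi_pos).mono_right
      atBot_le_cocompact
  refine ((Real.tendsto_integral_exp_smul_cocompact K).comp hw).congr fun J => ?_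
  refine integral_congr_ae (.of_forall fun l => ?_)
  have : 2 * Real.pi * -(l * (-(n J) / (2 * Real.pi))) = n J * l := by
    field_simp [Real.pi_ne_zero]
  simp only [Circle.smul_def, Real.fourierChar_apply, this, smul_eq_mul]
  push_cast
  ring_nf

/-- The limiting integrand, up to the oscillating factor. -/
def limitKernel (p1 p2 r : ℝ) (j : ℕ) (l : ℝ) : ℂ :=
  (Lam (-j)).indicator (fun l => (Dfn l : ℂ) * Pifn p1 p2 l * 2 ^ j * (r : ℂ)) l

@[fun_prop]
lemma measurable_limitKernel (p1 p2 r : ℝ) (j : ℕ) : Measurable (limitKernel p1 p2 r j) := by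
  unfold limitKernel
  exact Measurable.indicator (by fun_prop) (measurableSet_Lam _)

/-- The integrand of `rhoBar`. -/
def rhoIntegrand (R θv : ℕ → ℝ) (p1 p2 : ℝ) (j L J : ℕ) (th l : ℝ) : ℂ :=
  ((Dfn l : ℝ) : ℂ) * ((HjL j L l : ℝ) : ℂ) * Pifn p1 p2 l *
    Complex.exp (Complex.I * ((tauJ J)⁻¹ * th) * l) * fJ R θv J ((tauJ J)⁻¹ * l)

@[fun_prop]
lemma measurable_rhoIntegrand (R θv : ℕ → ℝ) (p1 p2 : ℝ) (j L J : ℕ) (th : ℝ) :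
    Measurable (rhoIntegrand R θv p1 p2 j L J th) := by
  unfold rhoIntegrand; fun_prop

lemma norm_exp_I_mul_mul (a b : ℝ) : ‖Complex.exp (Complex.I * a * b)‖ = 1 := by
  rw [mul_assoc, mul_comm, ← Complex.ofReal_mul, Complex.norm_exp_ofReal_mul_I]

section Pointwise

variable {R : ℕ → ℝ} (θv : ℕ → ℝ) {p1 p2 l : ℝ} {j : ℕ}

lemma rhoIntegrand_of_nonneg (R : ℕ → ℝ) (p1 p2 : ℝ) (j : ℕ) {m : ℤ}
    (h1 : (2 : ℝ) ^ m * Real.pi < |l|)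
    (h2 : |l| < (2 : ℝ) ^ (m + 1) * Real.pi) (hm : 0 ≤ m) (L J : ℕ) (th : ℝ) :
    rhoIntegrand R θv p1 p2 j L J th l = 0 := by
  rw [rhoIntegrand, fJ_inv_tauJ_mul_of_nonneg R θv h1 h2 hm, mul_zero]

lemma limitKernel_of_ne (p1 p2 r : ℝ) {m : ℤ} (h1 : (2 : ℝ) ^ m * Real.pi < |l|)
    (h2 : |l| < (2 : ℝ) ^ (m + 1) * Real.pi) (hm : m ≠ -j) : limitKernel p1 p2 r j l = 0 :=
  Set.indicator_of_notMem (fun h => hm ((mem_Lam_iff h1 h2 _).1 h).symm) _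

lemma norm_rhoIntegrand_le_HjL (hR : ∀ i, R i ∈ Set.Icc (-1 : ℝ) 1)
    (hp1 : p1 ∈ Set.Ico (0 : ℝ) 1) (hp2 : p2 ∈ Set.Ico (0 : ℝ) 1) {L : ℕ} (hL : Even L)
    {m : ℤ} (h1 : (2 : ℝ) ^ m * Real.pi < |l|)
    (h2 : |l| < (2 : ℝ) ^ (m + 1) * Real.pi) (J : ℕ) (th : ℝ) :
    ‖rhoIntegrand R θv p1 p2 j L J th l‖ ≤ HjL j L l := by
  have hH := HjL_nonneg j hL l
  have hf : ‖fJ R θv J ((tauJ J)⁻¹ * l)‖ ≤ 1 := by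
    rcases le_or_gt 0 m with hm | hm
    · simp [fJ_inv_tauJ_mul_of_nonneg R θv h1 h2 hm]
    · obtain ⟨n, rfl⟩ : ∃ n : ℕ, m = -n := ⟨m.natAbs, by omega⟩
      rw [fJ_inv_tauJ_mul_of_neg R θv (by omega) h1 h2]
      split_ifs
      · rw [norm_mul, Complex.exp_neg, norm_inv, norm_exp_I_mul_mul, inv_one, mul_one,
          Complex.norm_real]
        exact abs_le.2 (hR n)
      · simp
  have he : ‖Complex.exp (Complex.I * ((tauJ J)⁻¹ * th) * l)‖ = 1 := by
    simpa using norm_exp_I_mul_mul ((tauJ J)⁻¹ * th) l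
  have hΦ := norm_Dfn_mul_Pifn_le_one hp1 hp2 l
  have e : ‖rhoIntegrand R θv p1 p2 j L J th l‖ =
      ‖(Dfn l : ℂ) * Pifn p1 p2 l‖ * HjL j L l * ‖fJ R θv J ((tauJ J)⁻¹ * l)‖ := by
    rw [rhoIntegrand, norm_mul, norm_mul _ (Complex.exp _), he, mul_right_comm (Dfn l : ℂ),
      norm_mul _ (HjL j L l : ℂ), Complex.norm_of_nonneg hH, mul_one]
  rw [e]
  calc _ ≤ 1 * HjL j L l * 1 := by gcongr
    _ = _ := by ring

lemma norm_limitKernel_le (hp1 : p1 ∈ Set.Ico (0 : ℝ) 1) (hp2 : p2 ∈ Set.Ico (0 : ℝ) 1)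
    {r : ℝ} (hr : r ∈ Set.Icc (-1 : ℝ) 1) (j : ℕ) (l : ℝ) :
    ‖limitKernel p1 p2 r j l‖ ≤ 2 ^ j := by
  refine (norm_indicator_le_norm_self _ _).trans ?_
  have hΦ := norm_Dfn_mul_Pifn_le_one hp1 hp2 l
  have hr' : ‖(r : ℂ)‖ ≤ 1 := by rw [Complex.norm_real]; exact abs_le.2 hr
  rw [norm_mul, norm_mul, norm_pow, Complex.norm_ofNat]
  calc _ ≤ 1 * (2 : ℝ) ^ j * 1 := by gcongr
    _ = _ := by ring

lemma rhoIntegrand_sub_eq (R : ℕ → ℝ) (p1 p2 : ℝ) (hj : 1 ≤ j)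
    (h1 : (2 : ℝ) ^ (-j : ℤ) * Real.pi < |l|)
    (h2 : |l| < (2 : ℝ) ^ (-j + 1 : ℤ) * Real.pi) {J : ℕ} (hJ : j ≤ J + 1) (L : ℕ) (th : ℝ) :
    rhoIntegrand R θv p1 p2 j L J th l -
      Complex.exp (Complex.I * ((tauJ J)⁻¹ * (th - θv j) : ℝ) * l) * limitKernel p1 p2 (R j) j l =
    Complex.exp (Complex.I * ((tauJ J)⁻¹ * (th - θv j) : ℝ) * l) *
      ((Dfn l : ℂ) * Pifn p1 p2 l * (R j : ℂ)) * ((HjL j L l - 2 ^ j : ℝ) : ℂ) := by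
  have he : Complex.exp (Complex.I * ((tauJ J)⁻¹ * (th - θv j) : ℝ) * l) =
      Complex.exp (Complex.I * ((tauJ J)⁻¹ * th) * l) *
        Complex.exp (-(Complex.I * (θv j : ℝ) * ((tauJ J)⁻¹ * l : ℝ))) := by
    rw [← Complex.exp_add]
    push_cast
    ring_nf
  rw [limitKernel, Set.indicator_of_mem ((mem_Lam_iff h1 h2 _).2 rfl), rhoIntegrand,
    fJ_inv_tauJ_mul_of_neg R θv hj h1 h2, if_pos hJ, he]
  push_cast
  ring

end Pointwise

lemma ae_norm_rhoIntegrand_le {R : ℕ → ℝ} (θv : ℕ → ℝ) (hR : ∀ i, R i ∈ Set.Icc (-1 : ℝ) 1)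
    {p1 p2 : ℝ} (hp1 : p1 ∈ Set.Ico (0 : ℝ) 1) (hp2 : p2 ∈ Set.Ico (0 : ℝ) 1) {j L : ℕ}
    (hj : 1 ≤ j) (hL : Even L) (h0 : 0 < L) (J : ℕ) (th : ℝ) :
    ∀ᵐ l : ℝ, ‖rhoIntegrand R θv p1 p2 j L J th l‖ ≤
      (Set.Icc (-Real.pi) Real.pi).indicator (fun _ => (2 : ℝ) ^ j) l := by
  filter_upwards [ae_exists_mem_dyadic] with l ⟨m, h1, h2⟩
  by_cases hl : l ∈ Set.Icc (-Real.pi) Real.pi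
  · rw [Set.indicator_of_mem hl]
    exact (norm_rhoIntegrand_le_HjL θv hR hp1 hp2 hL h1 h2 J th).trans (HjL_le hj hL h0 l)
  · rw [Set.indicator_of_notMem hl, rhoIntegrand_of_nonneg θv R p1 p2 j h1 h2, norm_zero]
    by_contra hm
    refine hl (abs_le.1 (h2.le.trans ?_))
    exact mul_le_of_le_one_left Real.pi_pos.le (zpow_le_one_of_nonpos₀ one_le_two (by omega))

lemma ae_norm_limitKernel_le {p1 p2 : ℝ} (hp1 : p1 ∈ Set.Ico (0 : ℝ) 1)
    (hp2 : p2 ∈ Set.Ico (0 : ℝ) 1) {r : ℝ} (hr : r ∈ Set.Icc (-1 : ℝ) 1) {j : ℕ} (hj : 1 ≤ j) :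
    ∀ᵐ l : ℝ, ‖limitKernel p1 p2 r j l‖ ≤
      (Set.Icc (-Real.pi) Real.pi).indicator (fun _ => (2 : ℝ) ^ j) l := by
  filter_upwards [ae_exists_mem_dyadic] with l ⟨m, h1, h2⟩
  by_cases hl : l ∈ Set.Icc (-Real.pi) Real.pi
  · rw [Set.indicator_of_mem hl]
    exact norm_limitKernel_le hp1 hp2 hr j l
  · rw [Set.indicator_of_notMem hl, limitKernel_of_ne p1 p2 r h1 h2, norm_zero]
    rintro rfl
    refine hl (abs_le.1 (h2.le.trans ?_))
    exact mul_le_of_le_one_left Real.pi_pos.le (zpow_le_one_of_nonpos₀ one_le_two (by omega))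

lemma ae_tendsto_rhoIntegrand_sub {R : ℕ → ℝ} (θv : ℕ → ℝ)
    (hR : ∀ i, R i ∈ Set.Icc (-1 : ℝ) 1) {p1 p2 : ℝ} (hp1 : p1 ∈ Set.Ico (0 : ℝ) 1)
    (hp2 : p2 ∈ Set.Ico (0 : ℝ) 1) {j : ℕ} (hj : 1 ≤ j) {L : ℕ → ℕ} (hLeven : ∀ J, Even (L J))
    (hLpos : ∀ J, 0 < L J) (hLinf : Tendsto L atTop atTop) (ϑ : ℕ → ℝ) :
    ∀ᵐ l : ℝ, Tendsto (fun J => rhoIntegrand R θv p1 p2 j (L J) J (ϑ J) l -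
      Complex.exp (Complex.I * ((tauJ J)⁻¹ * (ϑ J - θv j) : ℝ) * l) *
        limitKernel p1 p2 (R j) j l) atTop (𝓝 0) := by
  filter_upwards [ae_exists_mem_dyadic] with l ⟨m, h1, h2⟩
  obtain ⟨k, rfl⟩ : ∃ k, j = k + 1 := ⟨j - 1, by omega⟩
  by_cases hm : m = -((k + 1 : ℕ) : ℤ)
  · subst hm
    have hH := tendsto_HjL_of_eq hLeven hLinf h1 h2
    have hH' : Tendsto (fun J => |HjL (k + 1) (L J) l - 2 ^ (k + 1)|) atTop (𝓝 0) := by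
      simpa using (hH.sub_const (2 ^ (k + 1))).abs
    refine squeeze_zero_norm' ((eventually_ge_atTop k).mono fun J hJ => ?_) hH'
    rw [rhoIntegrand_sub_eq θv R p1 p2 hj h1 h2 (by omega), norm_mul, norm_mul,
      norm_exp_I_mul_mul, norm_mul, Complex.norm_real, Complex.norm_real]
    have hΦ := norm_Dfn_mul_Pifn_le_one hp1 hp2 l
    have hr : ‖R (k + 1)‖ ≤ 1 := abs_le.2 (hR _)
    rw [one_mul]
    exact mul_le_of_le_one_left (norm_nonneg _) (mul_le_one₀ hΦ (norm_nonneg _) hr)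
  · simp only [limitKernel_of_ne p1 p2 _ h1 h2 hm, mul_zero, sub_zero]
    rcases le_or_gt 0 m with hm0 | hm0
    · simp only [rhoIntegrand_of_nonneg θv R p1 p2 _ h1 h2 hm0]
      exact tendsto_const_nhds
    · obtain ⟨n, rfl⟩ : ∃ n : ℕ, m = -((n + 1 : ℕ) : ℤ) := ⟨m.natAbs - 1, by omega⟩
      exact squeeze_zero_norm
        (fun J => norm_rhoIntegrand_le_HjL θv hR hp1 hp2 (hLeven J) h1 h2 J (ϑ J))
        (tendsto_HjL_of_ne hLeven hLpos hLinf (by omega) h1 h2)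

lemma tendsto_rhoBar {R : ℕ → ℝ} (θv : ℕ → ℝ)
    (hR : ∀ i, R i ∈ Set.Icc (-1 : ℝ) 1) {p1 p2 : ℝ} (hp1 : p1 ∈ Set.Ico (0 : ℝ) 1)
    (hp2 : p2 ∈ Set.Ico (0 : ℝ) 1) {j : ℕ} (hj : 1 ≤ j) {L : ℕ → ℕ} (hLeven : ∀ J, Even (L J))
    (hLpos : ∀ J, 0 < L J) (hLinf : Tendsto L atTop atTop) {ϑ : ℕ → ℝ}
    (hn : Tendsto (fun J => (tauJ J)⁻¹ * (ϑ J - θv j)) atTop atTop) :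
    Tendsto (fun J => rhoBar R θv p1 p2 j (L J) J (ϑ J)) atTop (𝓝 0) := by
  set b : ℝ → ℝ := (Set.Icc (-Real.pi) Real.pi).indicator (fun _ => (2 : ℝ) ^ j)
  have hb : Integrable b :=
    (integrableOn_const (by simp)).integrable_indicator measurableSet_Icc
  set G : ℕ → ℝ → ℂ := fun J l =>
    Complex.exp (Complex.I * ((tauJ J)⁻¹ * (ϑ J - θv j) : ℝ) * l) * limitKernel p1 p2 (R j) j l
    with hG
  have hFb : ∀ J, ∀ᵐ l : ℝ, ‖rhoIntegrand R θv p1 p2 j (L J) J (ϑ J) l‖ ≤ b l := fun J =>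
    ae_norm_rhoIntegrand_le θv hR hp1 hp2 hj (hLeven J) (hLpos J) J (ϑ J)
  have hGb : ∀ J, ∀ᵐ l : ℝ, ‖G J l‖ ≤ b l := fun J => by
    filter_upwards [ae_norm_limitKernel_le hp1 hp2 (hR j) hj] with l hl
    rwa [hG, norm_mul, norm_exp_I_mul_mul, one_mul]
  have hGm : ∀ J, Measurable (G J) := fun J => by fun_prop
  have hFm : ∀ J, Measurable (rhoIntegrand R θv p1 p2 j (L J) J (ϑ J)) := fun J => by fun_prop
  have hlim : Tendsto (fun J => ∫ l : ℝ, rhoIntegrand R θv p1 p2 j (L J) J (ϑ J) l - G J l) atTop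
      (𝓝 (∫ _l : ℝ, (0 : ℂ))) := by
    refine tendsto_integral_of_dominated_convergence (fun l => b l + b l)
      (fun J => ((hFm J).sub (hGm J)).aestronglyMeasurable) (hb.add hb) (fun J => ?_)
      (ae_tendsto_rhoIntegrand_sub θv hR hp1 hp2 hj hLeven hLpos hLinf ϑ)
    filter_upwards [hFb J, hGb J] with l h1 h2
    exact norm_sub_le_of_le h1 h2
  have hsum := hlim.add (tendsto_integral_exp_I_mul hn (limitKernel p1 p2 (R j) j))
  rw [integral_zero, zero_add] at hsum
  refine hsum.congr fun J => ?_
  rw [integral_sub (hb.mono' (hFm J).aestronglyMeasurable (hFb J))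
    (hb.mono' (hGm J).aestronglyMeasurable (hGb J))]
  exact sub_add_cancel _ _

open Filter in
theorem statement2
    (j : ℕ) (hj : 1 ≤ j) (R θv : ℕ → ℝ) (hR : ∀ i, R i ∈ Set.Icc (-1 : ℝ) 1)
    (p1 p2 : ℝ) (hp1 : p1 ∈ Set.Ico (0 : ℝ) 1) (hp2 : p2 ∈ Set.Ico (0 : ℝ) 1)
    (L : ℕ → ℕ) (hLeven : ∀ J, Even (L J)) (hLpos : ∀ J, 0 < L J)
    (hLinf : Tendsto (fun J => (L J : ℝ)) atTop atTop)
    (hL2tau : Tendsto (fun J => (L J : ℝ) ^ 2 * tauJ J) atTop (nhds 0))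
    (ϑ : ℕ → ℝ) (hgrid : ∀ J, ∃ k : ℤ, ϑ J = (k : ℝ) * tauJ J)
    (hdiv : Tendsto (fun J => (Real.sqrt (L J))⁻¹ * (tauJ J)⁻¹ * (ϑ J - θv j)) atTop atTop) :
    Tendsto (fun J => rhoBar R θv p1 p2 j (L J) J (ϑ J)) atTop (nhds 0) := by
  have hLnat : Tendsto L atTop atTop := tendsto_natCast_atTop_iff.1 hLinf
  refine tendsto_rhoBar θv hR hp1 hp2 hj hLeven hLpos hLnat
    (tendsto_atTop_mono' _ ?_ hdiv)
  filter_upwards [hdiv.eventually_ge_atTop 0] with J hJ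
  have hs : 1 ≤ Real.sqrt (L J) := Real.one_le_sqrt.2 (by exact_mod_cast hLpos J)
  have hs' : 0 < (Real.sqrt (L J))⁻¹ := by positivity
  rw [mul_assoc] at hJ ⊢
  exact mul_le_of_le_one_left (nonneg_of_mul_nonneg_right hJ hs') (inv_le_one_of_one_le₀ hs)

end
end
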